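/- Let H be a weak Hopf algebra over k and A a right H-comodule algebra with coinvariant subalgebra B. If the Galois map β : A⊗_B A → (A⊗H)ρ(1) is surjective, then A is finitely generated projective as a right B-module and β is bijective; that is, A|B is a weak H-Galois extension. -/

import Mathlib

noncomputable section

open TensorProduct LinearMap

/-- A weak bialgebra over a field `k`: a finite-dimensional `k`-algebra with a `k`-coalgebra
structure whose comultiplication is multiplicative, with the weakened unit and counit axioms. -/
structure WeakBialgebra (k : Type*) [Field k] (H : Type*) [Ring H] [Algebra k H]
    [FiniteDimensional k H] where
  comul : H →ₗ[k] H ⊗[k] H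
  counit : H →ₗ[k] k
  coassoc : ∀ x : H,
    (TensorProduct.assoc k H H H) ((rTensor H comul) (comul x)) = (lTensor H comul) (comul x)
  rTensor_counit_comul : ∀ x : H, (TensorProduct.lid k H) ((rTensor H counit) (comul x)) = x
  lTensor_counit_comul : ∀ x : H, (TensorProduct.rid k H) ((lTensor H counit) (comul x)) = x
  comul_mul : ∀ a b : H, comul (a * b) = comul a * comul b
  -- `1₍₁₎ ⊗ 1₍₂₎ ⊗ 1₍₃₎ = (Δ(1) ⊗ 1)(1 ⊗ Δ(1)) = (1 ⊗ Δ(1))(Δ(1) ⊗ 1)`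
  weak_one₁ : (lTensor H comul) (comul 1)
    = (TensorProduct.assoc k H H H) ((comul 1) ⊗ₜ[k] (1 : H)) * ((1 : H) ⊗ₜ[k] (comul 1))
  weak_one₂ : (lTensor H comul) (comul 1)
    = ((1 : H) ⊗ₜ[k] (comul 1)) * (TensorProduct.assoc k H H H) ((comul 1) ⊗ₜ[k] (1 : H))
  -- `ε(abc) = ε(ab₍₁₎)ε(b₍₂₎c) = ε(ab₍₂₎)ε(b₍₁₎c)`
  weak_counit₁ : ∀ a b c : H, counit (a * b * c)
    = (LinearMap.mul' k k)
        ((TensorProduct.map (counit ∘ₗ mulLeft k a) (counit ∘ₗ mulRight k c)) (comul b))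
  weak_counit₂ : ∀ a b c : H, counit (a * b * c)
    = (LinearMap.mul' k k)
        ((TensorProduct.map (counit ∘ₗ mulRight k c) (counit ∘ₗ mulLeft k a)) (comul b))

namespace WeakBialgebra

variable {k : Type*} [Field k] {H : Type*} [Ring H] [Algebra k H] [FiniteDimensional k H]
variable (wb : WeakBialgebra k H)

/-- `ε ⊗ id : H ⊗ H → H`. -/
def εid : H ⊗[k] H →ₗ[k] H := (TensorProduct.lid k H).toLinearMap ∘ₗ rTensor H wb.counit

/-- `id ⊗ ε : H ⊗ H → H`. -/
def idε : H ⊗[k] H →ₗ[k] H := (TensorProduct.rid k H).toLinearMap ∘ₗ lTensor H wb.counit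

/-- `Π^L(x) = ε(1₍₁₎x) 1₍₂₎`. -/
def projL : H →ₗ[k] H :=
  wb.εid ∘ₗ mulLeft k (wb.comul 1) ∘ₗ (TensorProduct.mk k H H).flip 1

/-- `Π^R(x) = 1₍₁₎ ε(x1₍₂₎)`. -/
def projR : H →ₗ[k] H :=
  wb.idε ∘ₗ mulRight k (wb.comul 1) ∘ₗ TensorProduct.mk k H H 1

/-- `Π̄^L(x) = 1₍₁₎ ε(1₍₂₎x)`. -/
def projBarL : H →ₗ[k] H :=
  wb.idε ∘ₗ mulLeft k (wb.comul 1) ∘ₗ TensorProduct.mk k H H 1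

/-- `Π̄^R(x) = ε(x1₍₁₎) 1₍₂₎`. -/
def projBarR : H →ₗ[k] H :=
  wb.εid ∘ₗ mulRight k (wb.comul 1) ∘ₗ (TensorProduct.mk k H H).flip 1

/-- The antipode axioms for a weak Hopf algebra: `S(x₍₁₎)x₍₂₎ = Π^R(x)`,
`x₍₁₎S(x₍₂₎) = Π^L(x)` and `S(x₍₁₎)x₍₂₎S(x₍₃₎) = S(x)`. -/
structure IsAntipode (S : H →ₗ[k] H) : Prop where
  antipode_left : ∀ x : H, LinearMap.mul' k H ((rTensor H S) (wb.comul x)) = wb.projR x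
  antipode_right : ∀ x : H, LinearMap.mul' k H ((lTensor H S) (wb.comul x)) = wb.projL x
  antipode_mid : ∀ x : H,
    LinearMap.mul' k H
      ((TensorProduct.map (LinearMap.mul' k H ∘ₗ rTensor H S) S)
        ((rTensor H wb.comul) (wb.comul x))) = S x

end WeakBialgebra

/-- A right `H`-comodule algebra over a weak bialgebra `H`. -/
structure ComodAlg {k : Type*} [Field k] {H : Type*} [Ring H] [Algebra k H]
    [FiniteDimensional k H] (wb : WeakBialgebra k H)
    (A : Type*) [Ring A] [Algebra k A] where
  ρ : A →ₗ[k] A ⊗[k] H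
  coassoc : ∀ a : A,
    (TensorProduct.assoc k A H H) ((rTensor H ρ) (ρ a)) = (lTensor A wb.comul) (ρ a)
  counital : ∀ a : A, (TensorProduct.rid k A) ((lTensor A wb.counit) (ρ a)) = a
  mul : ∀ a b : A, ρ (a * b) = ρ a * ρ b
  piL : ∀ a : A, (lTensor A wb.projL) (ρ a) = ρ 1 * (a ⊗ₜ[k] (1 : H))
  pibarR : ∀ a : A, (lTensor A wb.projBarR) (ρ a) = (a ⊗ₜ[k] (1 : H)) * ρ 1

namespace ComodAlg

variable {k : Type*} [Field k] {H : Type*} [Ring H] [Algebra k H] [FiniteDimensional k H]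
variable {wb : WeakBialgebra k H} {A : Type*} [Ring A] [Algebra k A]

/-- The coinvariant subalgebra `B = {b ∈ A : ρ(b) = 1₍₀₎b ⊗ 1₍₁₎}`. -/
def coinv (ca : ComodAlg wb A) : Set A := {b | ca.ρ b = ca.ρ 1 * (b ⊗ₜ[k] (1 : H))}

/-- The `B`-balancing relations in `A ⊗_k A`, realizing `A ⊗_B A`. -/
def rel (ca : ComodAlg wb A) : Submodule k (A ⊗[k] A) :=
  Submodule.span k
    {z | ∃ a a' b : A, b ∈ ca.coinv ∧ z = (a * b) ⊗ₜ[k] a' - a ⊗ₜ[k] (b * a')}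

/-- `A ⊗_B A`. -/
abbrev QA (ca : ComodAlg wb A) := (A ⊗[k] A) ⧸ ca.rel

/-- The canonical quotient map `A ⊗_k A → A ⊗_B A`. -/
def mkA (ca : ComodAlg wb A) : A ⊗[k] A →ₗ[k] ca.QA := ca.rel.mkQ

end ComodAlg

section Convolution

variable {k : Type*} [Field k] {M N P Q R : Type*}
  [AddCommGroup M] [Module k M] [AddCommGroup N] [Module k N] [AddCommGroup P] [Module k P]
  [Ring R] [Algebra k R]

/-- The convolution `m ↦ f(m₍₁₎) g(m₍₂₎)` of two linear maps along `δ : M → N ⊗ P`. -/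
def convAlong (δ : M →ₗ[k] N ⊗[k] P) (f : N →ₗ[k] R) (g : P →ₗ[k] R) : M →ₗ[k] R :=
  LinearMap.mul' k R ∘ₗ TensorProduct.map f g ∘ₗ δ

lemma convAlong_apply (δ : M →ₗ[k] N ⊗[k] P) (f : N →ₗ[k] R) (g : P →ₗ[k] R) (m : M) :
    convAlong δ f g m = LinearMap.mul' k R (TensorProduct.map f g (δ m)) := rfl

lemma convAlong_apply_of_eq_sum {δ : M →ₗ[k] N ⊗[k] P} (f : N →ₗ[k] R) (g : P →ₗ[k] R) {m : M}
    {ι : Type*} {s : Finset ι} {a : ι → N} {b : ι → P} (h : δ m = ∑ i ∈ s, a i ⊗ₜ[k] b i) :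
    convAlong δ f g m = ∑ i ∈ s, f (a i) * g (b i) := by
  simp [convAlong_apply, h]

lemma convAlong_assoc {δ : M →ₗ[k] M ⊗[k] P} {Δ : P →ₗ[k] P ⊗[k] P}
    (h : ∀ m, TensorProduct.assoc k M P P (rTensor P δ (δ m)) = lTensor M Δ (δ m))
    (e : M →ₗ[k] R) (f g : P →ₗ[k] R) :
    convAlong δ (convAlong δ e f) g = convAlong δ e (convAlong Δ f g) := by
  ext m
  have h₁ : ∀ t : M ⊗[k] P, LinearMap.mul' k R (TensorProduct.map (convAlong δ e f) g t) =
      LinearMap.mul' k R (TensorProduct.map e (LinearMap.mul' k R ∘ₗ TensorProduct.map f g)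
        (TensorProduct.assoc k M P P (rTensor P δ t))) := by
    intro t
    induction t with
    | zero => simp
    | add x y hx hy => simp only [map_add, hx, hy]
    | tmul x y =>
      simp only [map_tmul, convAlong_apply, rTensor_tmul, mul'_apply]
      induction δ x with
      | zero => simp
      | add x y hx hy => simp only [map_add, add_tmul, hx, hy, add_mul]
      | tmul a b => simp [mul_assoc]
  have h₂ : ∀ t : M ⊗[k] P, LinearMap.mul' k R (TensorProduct.map e (convAlong Δ f g) t) =
      LinearMap.mul' k R (TensorProduct.map e (LinearMap.mul' k R ∘ₗ TensorProduct.map f g)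
        (lTensor M Δ t)) := by
    intro t
    induction t with
    | zero => simp
    | add x y hx hy => simp only [map_add, hx, hy]
    | tmul x y => simp [convAlong_apply]
  rw [convAlong_apply, h₁, h, ← h₂, convAlong_apply]

lemma convAlong_mulLeft (δ : M →ₗ[k] N ⊗[k] P) (c : R) (f : N →ₗ[k] R) (g : P →ₗ[k] R) :
    convAlong δ (mulLeft k c ∘ₗ f) g = mulLeft k c ∘ₗ convAlong δ f g := by
  ext m
  simp only [convAlong_apply, LinearMap.comp_apply]
  induction δ m with
  | zero => simp
  | add x y hx hy => simp only [map_add, hx, hy]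
  | tmul a b => simp [mul_assoc]

lemma convAlong_mulRight (δ : M →ₗ[k] N ⊗[k] P) (c : R) (f : N →ₗ[k] R) (g : P →ₗ[k] R) :
    convAlong δ f (mulRight k c ∘ₗ g) = mulRight k c ∘ₗ convAlong δ f g := by
  ext m
  simp only [convAlong_apply, LinearMap.comp_apply]
  induction δ m with
  | zero => simp
  | add x y hx hy => simp only [map_add, hx, hy]
  | tmul a b => simp [mul_assoc]

lemma convAlong_mulRight_left (δ : M →ₗ[k] N ⊗[k] P) (c : R) (f : N →ₗ[k] R) (g : P →ₗ[k] R) :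
    convAlong δ (mulRight k c ∘ₗ f) g = convAlong δ f (mulLeft k c ∘ₗ g) := by
  ext m
  simp only [convAlong_apply]
  induction δ m with
  | zero => simp
  | add x y hx hy => simp only [map_add, hx, hy]
  | tmul a b => simp [mul_assoc]

lemma comp_convAlong {R' : Type*} [Ring R'] [Algebra k R'] (δ : M →ₗ[k] N ⊗[k] P)
    (σ : R →ₗ[k] R') (hσ : ∀ a b, σ (a * b) = σ a * σ b) (f : N →ₗ[k] R) (g : P →ₗ[k] R) :
    σ ∘ₗ convAlong δ f g = convAlong δ (σ ∘ₗ f) (σ ∘ₗ g) := by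
  ext m
  simp only [convAlong_apply, LinearMap.comp_apply]
  induction δ m with
  | zero => simp
  | add x y hx hy => simp only [map_add, hx, hy]
  | tmul a b => simp [hσ]

/-- Generalized inverses are unique. -/
lemma convAlong_inverse_unique {δ : M →ₗ[k] M ⊗[k] M}
    (h : ∀ m, TensorProduct.assoc k M M M (rTensor M δ (δ m)) = lTensor M δ (δ m))
    {f g g' : M →ₗ[k] R} (hl : convAlong δ g f = convAlong δ g' f)
    (hr : convAlong δ f g = convAlong δ f g') (hg : convAlong δ g (convAlong δ f g) = g)
    (hg' : convAlong δ g' (convAlong δ f g') = g') : g = g' := by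
  rw [← hg, hr, ← convAlong_assoc h, hl, convAlong_assoc h, hg']

end Convolution

section TensorSums

variable {k : Type*} [Field k] {M N : Type*}
  [AddCommGroup M] [Module k M] [AddCommGroup N] [Module k N]

lemma exists_eq_sum_contract_right [FiniteDimensional k N] (t : M ⊗[k] N) :
    t = ∑ j, (TensorProduct.rid k M
      (lTensor M ((Module.finBasis k N).coord j) t)) ⊗ₜ[k] Module.finBasis k N j := by
  induction t with
  | zero => simp
  | add x y hx hy =>
    simp only [map_add, add_tmul, Finset.sum_add_distrib]
    rw [← hx, ← hy]
  | tmul a b =>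
    conv_lhs => rw [← (Module.finBasis k N).sum_repr b, tmul_sum]
    simp [smul_tmul']

lemma exists_eq_sum_contract_left [FiniteDimensional k M] (t : M ⊗[k] N) :
    t = ∑ j, Module.finBasis k M j ⊗ₜ[k] (TensorProduct.lid k N
      (rTensor N ((Module.finBasis k M).coord j) t)) := by
  induction t with
  | zero => simp
  | add x y hx hy =>
    simp only [map_add, tmul_add, Finset.sum_add_distrib]
    rw [← hx, ← hy]
  | tmul a b =>
    conv_lhs => rw [← (Module.finBasis k M).sum_repr a, sum_tmul]
    simp [smul_tmul]

end TensorSums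

section TensorIdentities

variable {k : Type*} [Field k] {H : Type*} [Ring H] [Algebra k H]

lemma comul_lid_rTensor (Δ : H →ₗ[k] H ⊗[k] H) (φ : H →ₗ[k] k) (t : H ⊗[k] H) :
    Δ (TensorProduct.lid k H (rTensor H φ t)) =
      TensorProduct.lid k (H ⊗[k] H) (rTensor (H ⊗[k] H) φ (lTensor H Δ t)) := by
  induction t with
  | zero => simp
  | add x y hx hy => simp only [map_add, hx, hy]
  | tmul a b => simp

lemma comul_rid_lTensor (Δ : H →ₗ[k] H ⊗[k] H) (ψ : H →ₗ[k] k) (t : H ⊗[k] H) :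
    Δ (TensorProduct.rid k H (lTensor H ψ t)) =
      TensorProduct.rid k (H ⊗[k] H) (lTensor (H ⊗[k] H) ψ (rTensor H Δ t)) := by
  induction t with
  | zero => simp
  | add x y hx hy => simp only [map_add, hx, hy]
  | tmul a b => simp

lemma contract_left_mul (φ : H →ₗ[k] k) (t s : H ⊗[k] H) :
    TensorProduct.lid k (H ⊗[k] H) (rTensor (H ⊗[k] H) φ
      (TensorProduct.assoc k H H H (t ⊗ₜ[k] (1 : H)) * ((1 : H) ⊗ₜ[k] s))) =
      ((TensorProduct.lid k H (rTensor H φ t)) ⊗ₜ[k] (1 : H)) * s := by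
  induction t with
  | zero => simp
  | add x y hx hy => simp only [map_add, add_tmul, add_mul, hx, hy]
  | tmul a b =>
    simp only [assoc_tmul, Algebra.TensorProduct.tmul_mul_tmul, mul_one, rTensor_tmul,
      lid_tmul, ← smul_tmul', smul_mul_assoc]

lemma contract_left_mul' (φ : H →ₗ[k] k) (t s : H ⊗[k] H) :
    TensorProduct.lid k (H ⊗[k] H) (rTensor (H ⊗[k] H) φ
      (((1 : H) ⊗ₜ[k] s) * TensorProduct.assoc k H H H (t ⊗ₜ[k] (1 : H)))) =
      s * ((TensorProduct.lid k H (rTensor H φ t)) ⊗ₜ[k] (1 : H)) := by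
  induction t with
  | zero => simp
  | add x y hx hy => simp only [map_add, add_tmul, mul_add, hx, hy]
  | tmul a b =>
    simp only [assoc_tmul, Algebra.TensorProduct.tmul_mul_tmul, one_mul, rTensor_tmul, lid_tmul,
      ← smul_tmul', mul_smul_comm]

lemma contract_right_mul (ψ : H →ₗ[k] k) (t s : H ⊗[k] H) :
    TensorProduct.rid k (H ⊗[k] H) (lTensor (H ⊗[k] H) ψ ((TensorProduct.assoc k H H H).symm
      (TensorProduct.assoc k H H H (t ⊗ₜ[k] (1 : H)) * ((1 : H) ⊗ₜ[k] s)))) =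
      t * ((1 : H) ⊗ₜ[k] (TensorProduct.rid k H (lTensor H ψ s))) := by
  induction t with
  | zero => simp
  | add x y hx hy => simp only [map_add, add_tmul, add_mul, hx, hy]
  | tmul a b =>
    induction s with
    | zero => simp
    | add x y hx hy => simp only [map_add, tmul_add, mul_add, hx, hy]
    | tmul c d => simp

lemma contract_right_mul' (ψ : H →ₗ[k] k) (t s : H ⊗[k] H) :
    TensorProduct.rid k (H ⊗[k] H) (lTensor (H ⊗[k] H) ψ ((TensorProduct.assoc k H H H).symm
      (((1 : H) ⊗ₜ[k] s) * TensorProduct.assoc k H H H (t ⊗ₜ[k] (1 : H))))) =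
      ((1 : H) ⊗ₜ[k] (TensorProduct.rid k H (lTensor H ψ s))) * t := by
  induction t with
  | zero => simp
  | add x y hx hy => simp only [map_add, add_tmul, mul_add, hx, hy]
  | tmul a b =>
    induction s with
    | zero => simp
    | add x y hx hy => simp only [map_add, tmul_add, add_mul, hx, hy]
    | tmul c d => simp

lemma rid_lTensor_tmul_one_mul {A : Type*} [Ring A] [Algebra k A] (Λ : H →ₗ[k] k) (a : A)
    (t : A ⊗[k] H) :
    TensorProduct.rid k A (lTensor A Λ ((a ⊗ₜ[k] (1 : H)) * t)) =
      a * TensorProduct.rid k A (lTensor A Λ t) := by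
  induction t with
  | zero => simp
  | add x y hx hy => simp only [map_add, mul_add, hx, hy]
  | tmul a b => simp

lemma rid_lTensor_mul_tmul_one {A : Type*} [Ring A] [Algebra k A] (Λ : H →ₗ[k] k) (a : A)
    (t : A ⊗[k] H) :
    TensorProduct.rid k A (lTensor A Λ (t * (a ⊗ₜ[k] (1 : H)))) =
      TensorProduct.rid k A (lTensor A Λ t) * a := by
  induction t with
  | zero => simp
  | add x y hx hy => simp only [map_add, add_mul, hx, hy]
  | tmul a b => simp

end TensorIdentities

namespace WeakBialgebra

variable {k : Type*} [Field k] {H : Type*} [Ring H] [Algebra k H] [FiniteDimensional k H]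
variable (wb : WeakBialgebra k H)

lemma comul_one_mul (x : H) : wb.comul 1 * wb.comul x = wb.comul x := by
  rw [← wb.comul_mul, one_mul]

lemma comul_mul_one (x : H) : wb.comul x * wb.comul 1 = wb.comul x := by
  rw [← wb.comul_mul, mul_one]

/-- `φ(1₍₁₎) 1₍₂₎`. -/
def legL (φ : H →ₗ[k] k) : H := TensorProduct.lid k H (rTensor H φ (wb.comul 1))

/-- `1₍₁₎ ψ(1₍₂₎)`. -/
def legR (ψ : H →ₗ[k] k) : H := TensorProduct.rid k H (lTensor H ψ (wb.comul 1))

/-- The elements `z` with `Δ(z) = 1₍₁₎z ⊗ 1₍₂₎ = z1₍₁₎ ⊗ 1₍₂₎`. -/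
structure IsL (z : H) : Prop where
  comul_right : wb.comul z = wb.comul 1 * (z ⊗ₜ[k] (1 : H))
  comul_left : wb.comul z = (z ⊗ₜ[k] (1 : H)) * wb.comul 1

/-- The elements `w` with `Δ(w) = 1₍₁₎ ⊗ 1₍₂₎w = 1₍₁₎ ⊗ w1₍₂₎`. -/
structure IsR (w : H) : Prop where
  comul_right : wb.comul w = wb.comul 1 * ((1 : H) ⊗ₜ[k] w)
  comul_left : wb.comul w = ((1 : H) ⊗ₜ[k] w) * wb.comul 1

lemma isL_legL (φ : H →ₗ[k] k) : wb.IsL (wb.legL φ) where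
  comul_right := by rw [legL, comul_lid_rTensor, wb.weak_one₂, contract_left_mul']
  comul_left := by rw [legL, comul_lid_rTensor, wb.weak_one₁, contract_left_mul]

lemma rTensor_comul_one :
    rTensor H wb.comul (wb.comul 1) =
      (TensorProduct.assoc k H H H).symm (lTensor H wb.comul (wb.comul 1)) := by
  rw [← wb.coassoc, LinearEquiv.symm_apply_apply]

lemma isR_legR (ψ : H →ₗ[k] k) : wb.IsR (wb.legR ψ) where
  comul_right := by
    rw [legR, comul_rid_lTensor, rTensor_comul_one, wb.weak_one₁, contract_right_mul]
  comul_left := by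
    rw [legR, comul_rid_lTensor, rTensor_comul_one, wb.weak_one₂, contract_right_mul']

variable {wb}

lemma IsL.commute_legR {z : H} (hz : wb.IsL z) (ψ : H →ₗ[k] k) :
    z * wb.legR ψ = wb.legR ψ * z := by
  rw [legR, ← rid_lTensor_tmul_one_mul, ← rid_lTensor_mul_tmul_one, ← hz.comul_left,
    hz.comul_right]

lemma IsL.comul_mul_right {z : H} (hz : wb.IsL z) (x : H) :
    wb.comul (x * z) = wb.comul x * (z ⊗ₜ[k] (1 : H)) := by
  rw [wb.comul_mul, hz.comul_right, ← mul_assoc, comul_mul_one]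

lemma IsL.comul_mul_left {z : H} (hz : wb.IsL z) (x : H) :
    wb.comul (z * x) = (z ⊗ₜ[k] (1 : H)) * wb.comul x := by
  rw [wb.comul_mul, hz.comul_left, mul_assoc, comul_one_mul]

lemma IsR.comul_mul_right {w : H} (hw : wb.IsR w) (x : H) :
    wb.comul (x * w) = wb.comul x * ((1 : H) ⊗ₜ[k] w) := by
  rw [wb.comul_mul, hw.comul_right, ← mul_assoc, comul_mul_one]

lemma IsR.comul_mul_left {w : H} (hw : wb.IsR w) (x : H) :
    wb.comul (w * x) = ((1 : H) ⊗ₜ[k] w) * wb.comul x := by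
  rw [wb.comul_mul, hw.comul_left, mul_assoc, comul_one_mul]

variable (wb)

lemma projL_eq_legL (x : H) : wb.projL x = wb.legL (wb.counit ∘ₗ mulRight k x) := by
  simp only [projL, εid, legL, LinearMap.comp_apply, flip_apply, TensorProduct.mk_apply,
    mulLeft_apply, LinearEquiv.coe_coe]
  induction wb.comul 1 with
  | zero => simp
  | add x y hx hy => simp only [map_add, add_mul, hx, hy]
  | tmul a b => simp

lemma projBarR_eq_legL (x : H) : wb.projBarR x = wb.legL (wb.counit ∘ₗ mulLeft k x) := by
  simp only [projBarR, εid, legL, LinearMap.comp_apply, flip_apply, TensorProduct.mk_apply,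
    mulRight_apply, LinearEquiv.coe_coe]
  induction wb.comul 1 with
  | zero => simp
  | add x y hx hy => simp only [map_add, mul_add, hx, hy]
  | tmul a b => simp

lemma projR_eq_legR (x : H) : wb.projR x = wb.legR (wb.counit ∘ₗ mulLeft k x) := by
  simp only [projR, idε, legR, LinearMap.comp_apply, TensorProduct.mk_apply,
    mulRight_apply, LinearEquiv.coe_coe]
  induction wb.comul 1 with
  | zero => simp
  | add x y hx hy => simp only [map_add, mul_add, hx, hy]
  | tmul a b => simp

lemma projBarL_eq_legR (x : H) : wb.projBarL x = wb.legR (wb.counit ∘ₗ mulRight k x) := by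
  simp only [projBarL, idε, legR, LinearMap.comp_apply, TensorProduct.mk_apply,
    mulLeft_apply, LinearEquiv.coe_coe]
  induction wb.comul 1 with
  | zero => simp
  | add x y hx hy => simp only [map_add, add_mul, hx, hy]
  | tmul a b => simp

lemma isL_projL (x : H) : wb.IsL (wb.projL x) := wb.projL_eq_legL x ▸ wb.isL_legL _
lemma isL_projBarR (x : H) : wb.IsL (wb.projBarR x) := wb.projBarR_eq_legL x ▸ wb.isL_legL _
lemma isR_projR (x : H) : wb.IsR (wb.projR x) := wb.projR_eq_legR x ▸ wb.isR_legR _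
lemma isR_projBarL (x : H) : wb.IsR (wb.projBarL x) := wb.projBarL_eq_legR x ▸ wb.isR_legR _

lemma counit_mul_legL (c : H) (φ : H →ₗ[k] k) : wb.counit (wb.legL φ * c) =
    LinearMap.mul' k k (TensorProduct.map φ (wb.counit ∘ₗ mulRight k c) (wb.comul 1)) := by
  rw [legL]
  induction wb.comul 1 with
  | zero => simp
  | add x y hx hy => simp only [map_add, add_mul, hx, hy]
  | tmul a b => simp

lemma counit_mul_legR (c : H) (ψ : H →ₗ[k] k) : wb.counit (wb.legR ψ * c) =
    LinearMap.mul' k k (TensorProduct.map (wb.counit ∘ₗ mulRight k c) ψ (wb.comul 1)) := by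
  rw [legR]
  induction wb.comul 1 with
  | zero => simp
  | add x y hx hy => simp only [map_add, add_mul, hx, hy]
  | tmul a b => simp [mul_comm]

lemma counit_legL_mul (a : H) (φ : H →ₗ[k] k) : wb.counit (a * wb.legL φ) =
    LinearMap.mul' k k (TensorProduct.map φ (wb.counit ∘ₗ mulLeft k a) (wb.comul 1)) := by
  rw [legL]
  induction wb.comul 1 with
  | zero => simp
  | add x y hx hy => simp only [map_add, mul_add, hx, hy]
  | tmul a b => simp

lemma counit_legR_mul (a : H) (ψ : H →ₗ[k] k) : wb.counit (a * wb.legR ψ) =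
    LinearMap.mul' k k (TensorProduct.map (wb.counit ∘ₗ mulLeft k a) ψ (wb.comul 1)) := by
  rw [legR]
  induction wb.comul 1 with
  | zero => simp
  | add x y hx hy => simp only [map_add, mul_add, hx, hy]
  | tmul a b => simp [mul_comm]

lemma counit_projBarR_mul (x y : H) : wb.counit (wb.projBarR x * y) = wb.counit (x * y) := by
  rw [projBarR_eq_legL, counit_mul_legL, ← wb.weak_counit₁, mul_one]

lemma counit_projR_mul (x y : H) : wb.counit (wb.projR x * y) = wb.counit (x * y) := by
  rw [projR_eq_legR, counit_mul_legR, ← wb.weak_counit₂, mul_one]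

lemma counit_mul_projL (x y : H) : wb.counit (x * wb.projL y) = wb.counit (x * y) := by
  rw [projL_eq_legL, counit_legL_mul, ← wb.weak_counit₂, mul_one]

lemma counit_mul_projBarL (x y : H) : wb.counit (x * wb.projBarL y) = wb.counit (x * y) := by
  rw [projBarL_eq_legR, counit_legR_mul, ← wb.weak_counit₁, mul_one]

lemma projR_congr {x y : H} (h : ∀ c, wb.counit (x * c) = wb.counit (y * c)) :
    wb.projR x = wb.projR y := by
  rw [projR_eq_legR, projR_eq_legR]
  congr 1
  ext c
  exact h c

lemma projL_congr {x y : H} (h : ∀ c, wb.counit (c * x) = wb.counit (c * y)) :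
    wb.projL x = wb.projL y := by
  rw [projL_eq_legL, projL_eq_legL]
  congr 1
  ext c
  exact h c

lemma projR_projBarR (x : H) : wb.projR (wb.projBarR x) = wb.projR x :=
  wb.projR_congr (wb.counit_projBarR_mul x)

lemma projL_projBarL (x : H) : wb.projL (wb.projBarL x) = wb.projL x :=
  wb.projL_congr fun c => wb.counit_mul_projBarL c x

lemma projL_mul_projL (x y : H) : wb.projL (x * wb.projL y) = wb.projL (x * y) :=
  wb.projL_congr fun c => by rw [← mul_assoc, counit_mul_projL, mul_assoc]

lemma projR_projR_mul (x y : H) : wb.projR (wb.projR x * y) = wb.projR (x * y) :=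
  wb.projR_congr fun c => by rw [mul_assoc, counit_projR_mul, mul_assoc]

lemma projR_one : wb.projR 1 = 1 := by
  rw [projR_eq_legR, legR, mulLeft_one, LinearMap.comp_id]
  exact wb.lTensor_counit_comul 1

lemma projL_one : wb.projL 1 = 1 := by
  rw [projL_eq_legL, legL, mulRight_one, LinearMap.comp_id]
  exact wb.rTensor_counit_comul 1

/-- `ε(1₍₁₎z) 1₍₂₎ = z` if `Δ(z) = 1₍₁₎z ⊗ 1₍₂₎`. -/
lemma projL_of_isL {z : H} (hz : wb.IsL z) : wb.projL z = z := by
  conv_rhs => rw [← wb.rTensor_counit_comul z, hz.comul_right]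
  rfl

lemma projR_of_isR {w : H} (hw : wb.IsR w) : wb.projR w = w := by
  conv_rhs => rw [← wb.lTensor_counit_comul w, hw.comul_left]
  rfl

end WeakBialgebra

namespace WeakBialgebra

variable {k : Type*} [Field k] {H : Type*} [Ring H] [Algebra k H] [FiniteDimensional k H]
variable (wb : WeakBialgebra k H)

lemma comul_one_eq_sum_legR :
    wb.comul 1 = ∑ j, wb.legR ((Module.finBasis k H).coord j) ⊗ₜ[k] Module.finBasis k H j :=
  exists_eq_sum_contract_right _

lemma comul_one_eq_sum_legL :
    wb.comul 1 = ∑ j, Module.finBasis k H j ⊗ₜ[k] wb.legL ((Module.finBasis k H).coord j) :=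
  exists_eq_sum_contract_left _

lemma projL_eq_sum (x : H) : wb.projL x = ∑ j,
    wb.counit (wb.legR ((Module.finBasis k H).coord j) * x) • Module.finBasis k H j := by
  rw [projL_eq_legL, legL, comul_one_eq_sum_legR]
  simp

lemma projR_eq_sum (x : H) : wb.projR x = ∑ j,
    wb.counit (x * wb.legL ((Module.finBasis k H).coord j)) • Module.finBasis k H j := by
  rw [projR_eq_legR, legR, comul_one_eq_sum_legL]
  simp

/-- `x₍₁₎ ⊗ Π^L(x₍₂₎) = 1₍₁₎x ⊗ 1₍₂₎`. -/
lemma lTensor_projL_comul (x : H) :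
    lTensor H wb.projL (wb.comul x) = wb.comul 1 * (x ⊗ₜ[k] (1 : H)) := by
  have key : ∀ t : H ⊗[k] H, lTensor H wb.projL t = ∑ j,
      TensorProduct.rid k H (lTensor H wb.counit
        (((1 : H) ⊗ₜ[k] wb.legR ((Module.finBasis k H).coord j)) * t)) ⊗ₜ[k]
        Module.finBasis k H j := by
    intro t
    induction t with
    | zero => simp
    | add x y hx hy => simp only [map_add, mul_add, add_tmul, Finset.sum_add_distrib, hx, hy]
    | tmul a b =>
      rw [lTensor_tmul, projL_eq_sum, tmul_sum]
      simp [smul_tmul]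
  conv_rhs => rw [comul_one_eq_sum_legR]
  rw [key, Finset.sum_mul]
  refine Finset.sum_congr rfl fun j _ => ?_
  rw [← (wb.isR_legR _).comul_mul_left, wb.lTensor_counit_comul,
    Algebra.TensorProduct.tmul_mul_tmul, mul_one]

/-- `Π^R(x₍₁₎) ⊗ x₍₂₎ = 1₍₁₎ ⊗ x1₍₂₎`. -/
lemma rTensor_projR_comul (x : H) :
    rTensor H wb.projR (wb.comul x) = ((1 : H) ⊗ₜ[k] x) * wb.comul 1 := by
  have key : ∀ t : H ⊗[k] H, rTensor H wb.projR t = ∑ j, Module.finBasis k H j ⊗ₜ[k]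
      TensorProduct.lid k H (rTensor H wb.counit
        (t * (wb.legL ((Module.finBasis k H).coord j) ⊗ₜ[k] (1 : H)))) := by
    intro t
    induction t with
    | zero => simp
    | add x y hx hy => simp only [map_add, add_mul, tmul_add, Finset.sum_add_distrib, hx, hy]
    | tmul a b =>
      rw [rTensor_tmul, projR_eq_sum, sum_tmul]
      simp [smul_tmul]
  conv_rhs => rw [comul_one_eq_sum_legL]
  rw [key, Finset.mul_sum]
  refine Finset.sum_congr rfl fun j _ => ?_
  rw [← (wb.isL_legL _).comul_mul_right, wb.rTensor_counit_comul,
    Algebra.TensorProduct.tmul_mul_tmul, one_mul]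

/-- `x₍₁₎ Π^R(x₍₂₎) = x`. -/
lemma convAlong_id_projR : convAlong wb.comul LinearMap.id wb.projR = LinearMap.id := by
  ext x
  have key : ∀ t : H ⊗[k] H, LinearMap.mul' k H (TensorProduct.map LinearMap.id wb.projR t) =
      TensorProduct.rid k H (lTensor H wb.counit (t * wb.comul 1)) := by
    intro t
    induction t with
    | zero => simp
    | add x y hx hy => simp only [map_add, add_mul, hx, hy]
    | tmul a b =>
      rw [map_tmul, projR_eq_legR, legR, mul'_apply, id_apply]
      induction wb.comul 1 with
      | zero => simp
      | add x y hx hy => simp only [map_add, mul_add, hx, hy]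
      | tmul c d => simp
  rw [convAlong_apply, key, comul_mul_one, wb.lTensor_counit_comul, id_apply]

lemma convAlong_comul_assoc {R : Type*} [Ring R] [Algebra k R] (e f g : H →ₗ[k] R) :
    convAlong wb.comul (convAlong wb.comul e f) g =
      convAlong wb.comul e (convAlong wb.comul f g) :=
  convAlong_assoc wb.coassoc e f g

variable {wb}

lemma exists_comul_eq_sum (wb : WeakBialgebra k H) (x : H) :
    ∃ (s : Finset (H × H)), wb.comul x = ∑ i ∈ s, i.1 ⊗ₜ[k] i.2 :=
  TensorProduct.exists_finset _

lemma convAlong_comul_comp_mulLeft {R : Type*} [Ring R] [Algebra k R] {w : H} (hw : wb.IsR w)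
    (f g : H →ₗ[k] R) :
    convAlong wb.comul f (g ∘ₗ mulLeft k w) = convAlong wb.comul f g ∘ₗ mulLeft k w := by
  ext x
  rw [convAlong_apply, LinearMap.comp_apply, convAlong_apply, mulLeft_apply, hw.comul_mul_left]
  induction wb.comul x with
  | zero => simp
  | add x y hx hy => simp only [map_add, mul_add, hx, hy]
  | tmul a b => simp

lemma convAlong_comul_comp_mulRight {R : Type*} [Ring R] [Algebra k R] {z : H} (hz : wb.IsL z)
    (f g : H →ₗ[k] R) :
    convAlong wb.comul (f ∘ₗ mulRight k z) g = convAlong wb.comul f g ∘ₗ mulRight k z := by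
  ext x
  rw [convAlong_apply, LinearMap.comp_apply, convAlong_apply, mulRight_apply, hz.comul_mul_right]
  induction wb.comul x with
  | zero => simp
  | add x y hx hy => simp only [map_add, add_mul, hx, hy]
  | tmul a b => simp

lemma IsL.commute_projR {z : H} (hz : wb.IsL z) (x : H) : z * wb.projR x = wb.projR x * z := by
  rw [projR_eq_legR, hz.commute_legR]

namespace IsAntipode

variable {S : H →ₗ[k] H} (hS : wb.IsAntipode S)
include hS

lemma convAlong_left : convAlong wb.comul S LinearMap.id = wb.projR :=
  LinearMap.ext hS.antipode_left

lemma convAlong_right : convAlong wb.comul LinearMap.id S = wb.projL :=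
  LinearMap.ext hS.antipode_right

/-- `Π^R(x₍₁₎) S(x₍₂₎) = S(x)`. -/
lemma convAlong_projR_self : convAlong wb.comul wb.projR S = S := by
  ext x
  conv_rhs => rw [← hS.antipode_mid x]
  rw [convAlong_apply]
  congr 1
  induction wb.comul x with
  | zero => simp
  | add x y hx hy => simp only [map_add, hx, hy]
  | tmul a b =>
    rw [map_tmul, rTensor_tmul, map_tmul, LinearMap.comp_apply, hS.antipode_left]

/-- `S(x₍₁₎) Π^L(x₍₂₎) = S(x)`. -/
lemma convAlong_self_projL : convAlong wb.comul S wb.projL = S := by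
  rw [← hS.convAlong_right, ← convAlong_comul_assoc, hS.convAlong_left, hS.convAlong_projR_self]

/-- `Π^L(x₍₁₎) x₍₂₎ = x`. -/
lemma convAlong_projL_id : convAlong wb.comul wb.projL LinearMap.id = LinearMap.id := by
  rw [← hS.convAlong_right, convAlong_comul_assoc, hS.convAlong_left, convAlong_id_projR]

/-- The antipode is antimultiplicative. -/
theorem antipode_mul (x y : H) : S (x * y) = S y * S x := by
  let : Coalgebra k H :=
    { comul := wb.comul
      counit := wb.counit
      coassoc := LinearMap.ext wb.coassoc
      rTensor_counit_comp_comul := by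
        ext x
        apply (TensorProduct.lid k H).injective
        simpa using wb.rTensor_counit_comul x
      lTensor_counit_comp_comul := by
        ext x
        apply (TensorProduct.rid k H).injective
        simpa using wb.lTensor_counit_comul x }
  set δ : H ⊗[k] H →ₗ[k] (H ⊗[k] H) ⊗[k] (H ⊗[k] H) := Coalgebra.comul with hδ
  have hδ' : ∀ {x y : H} {s t : Finset (H × H)}, wb.comul x = ∑ i ∈ s, i.1 ⊗ₜ[k] i.2 →
      wb.comul y = ∑ i ∈ t, i.1 ⊗ₜ[k] i.2 → δ (x ⊗ₜ[k] y) =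
      ∑ p ∈ s ×ˢ t, (p.1.1 ⊗ₜ[k] p.2.1) ⊗ₜ[k] (p.1.2 ⊗ₜ[k] p.2.2) := by
    intro x y s t hs ht
    have hs' : (Coalgebra.comul x : H ⊗[k] H) = ∑ i ∈ s, i.1 ⊗ₜ[k] i.2 := hs
    have ht' : (Coalgebra.comul y : H ⊗[k] H) = ∑ i ∈ t, i.1 ⊗ₜ[k] i.2 := ht
    rw [hδ, TensorProduct.comul_tmul, hs', ht', Finset.sum_product, sum_tmul]
    simp [tmul_sum]
  let μ : H ⊗[k] H →ₗ[k] H := LinearMap.mul' k H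
  let ν : H ⊗[k] H →ₗ[k] H :=
    LinearMap.mul' k H ∘ₗ TensorProduct.map S S ∘ₗ (TensorProduct.comm k H H).toLinearMap
  have hν : ∀ a b : H, ν (a ⊗ₜ[k] b) = S b * S a := fun a b => by simp [ν]
  have hμ : ∀ a b : H, μ (a ⊗ₜ[k] b) = a * b := fun a b => by simp [μ]
  have comp_μ : ∀ f g : H →ₗ[k] H, convAlong δ (f ∘ₗ μ) (g ∘ₗ μ) =
      convAlong wb.comul f g ∘ₗ μ := by
    intro f g
    refine TensorProduct.ext' fun x y => ?_
    obtain ⟨s, hs⟩ := wb.exists_comul_eq_sum x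
    obtain ⟨t, ht⟩ := wb.exists_comul_eq_sum y
    rw [convAlong_apply_of_eq_sum _ _ (hδ' hs ht), LinearMap.comp_apply, hμ, convAlong_apply,
      wb.comul_mul, hs, ht, Finset.sum_mul_sum, Finset.sum_product]
    simp [hμ]
  have left : convAlong δ ν μ = wb.projR ∘ₗ μ := by
    refine TensorProduct.ext' fun x y => ?_
    obtain ⟨s, hs⟩ := wb.exists_comul_eq_sum x
    obtain ⟨t, ht⟩ := wb.exists_comul_eq_sum y
    have h₁ : wb.projR x = ∑ i ∈ s, S i.1 * i.2 := by
      rw [← hS.convAlong_left]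
      exact convAlong_apply_of_eq_sum _ _ hs
    have h₂ := LinearMap.congr_fun
      (convAlong_comul_comp_mulLeft (wb.isR_projR x) S LinearMap.id) y
    rw [hS.convAlong_left, convAlong_apply_of_eq_sum _ _ ht] at h₂
    rw [convAlong_apply_of_eq_sum _ _ (hδ' hs ht), LinearMap.comp_apply, hμ, ← projR_projR_mul]
    refine Eq.trans ?_ h₂
    simp [hμ, hν, h₁, Finset.sum_product_right, Finset.sum_mul, Finset.mul_sum, mul_assoc]
  have right : ∀ x y : H, convAlong δ μ ν (x ⊗ₜ[k] y) =
      convAlong wb.comul LinearMap.id (mulLeft k (wb.projL y) ∘ₗ S) x := by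
    intro x y
    obtain ⟨s, hs⟩ := wb.exists_comul_eq_sum x
    obtain ⟨t, ht⟩ := wb.exists_comul_eq_sum y
    have h₁ : wb.projL y = ∑ i ∈ t, i.1 * S i.2 := by
      rw [← hS.convAlong_right]
      exact convAlong_apply_of_eq_sum _ _ ht
    rw [convAlong_apply_of_eq_sum _ _ (hδ' hs ht), convAlong_apply_of_eq_sum _ _ hs]
    simp [hμ, hν, h₁, Finset.sum_product, Finset.sum_mul, Finset.mul_sum, mul_assoc]
  have right' : convAlong δ μ ν = wb.projL ∘ₗ μ := by
    refine TensorProduct.ext' fun x y => ?_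
    have h := convAlong_comul_comp_mulRight (wb.isL_projL y) LinearMap.id S
    rw [LinearMap.id_comp, hS.convAlong_right] at h
    rw [right, ← convAlong_mulRight_left, LinearMap.comp_id, h, LinearMap.comp_apply,
      mulRight_apply, projL_mul_projL, LinearMap.comp_apply, hμ]
  have mid : convAlong δ ν (convAlong δ μ ν) = ν := by
    refine TensorProduct.ext' fun x y => ?_
    obtain ⟨s, hs⟩ := wb.exists_comul_eq_sum x
    obtain ⟨t, ht⟩ := wb.exists_comul_eq_sum y
    have inner : ∀ z : H, wb.IsL z → ∑ i ∈ s, S i.1 *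
        convAlong wb.comul LinearMap.id (mulLeft k z ∘ₗ S) i.2 = z * S x := by
      intro z hz
      have hc : mulRight k z ∘ₗ wb.projR = mulLeft k z ∘ₗ wb.projR :=
        LinearMap.ext fun c => (hz.commute_projR c).symm
      rw [← convAlong_apply_of_eq_sum _ _ hs, ← convAlong_comul_assoc, hS.convAlong_left,
        ← convAlong_mulRight_left, hc, convAlong_mulLeft, hS.convAlong_projR_self]
      rfl
    have outer : ∑ j ∈ t, S j.1 * wb.projL j.2 = S y := by
      rw [← convAlong_apply_of_eq_sum _ _ ht, hS.convAlong_self_projL]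
    rw [convAlong_apply_of_eq_sum _ _ (hδ' hs ht), hν, ← outer, Finset.sum_product_right,
      Finset.sum_mul]
    refine Finset.sum_congr rfl fun j _ => ?_
    rw [mul_assoc, ← inner _ (wb.isL_projL j.2), Finset.mul_sum]
    simp [hν, right, mul_assoc]
  have hSμ : convAlong δ (S ∘ₗ μ) μ = wb.projR ∘ₗ μ := by
    have := comp_μ S LinearMap.id
    rwa [hS.convAlong_left, LinearMap.id_comp] at this
  have hμS : convAlong δ μ (S ∘ₗ μ) = wb.projL ∘ₗ μ := by
    have := comp_μ LinearMap.id S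
    rwa [hS.convAlong_right, LinearMap.id_comp] at this
  have main : S ∘ₗ μ = ν := by
    refine convAlong_inverse_unique (fun m => LinearMap.congr_fun Coalgebra.coassoc m)
      (hSμ.trans left.symm) (hμS.trans right'.symm) ?_ mid
    rw [hμS, comp_μ, hS.convAlong_self_projL]
  simpa [hμ, hν] using LinearMap.congr_fun main (x ⊗ₜ[k] y)

end IsAntipode

end WeakBialgebra

namespace WeakBialgebra

variable {k : Type*} [Field k] {H : Type*} [Ring H] [Algebra k H] [FiniteDimensional k H]
variable {wb : WeakBialgebra k H}

namespace IsAntipode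

variable {S : H →ₗ[k] H} (hS : wb.IsAntipode S)
include hS

lemma sum_antipode_mul {x : H} {s : Finset (H × H)}
    (hs : wb.comul x = ∑ i ∈ s, i.1 ⊗ₜ[k] i.2) : ∑ i ∈ s, S i.1 * i.2 = wb.projR x := by
  rw [← hS.convAlong_left, convAlong_apply_of_eq_sum _ _ hs]
  rfl

lemma sum_mul_antipode {x : H} {s : Finset (H × H)}
    (hs : wb.comul x = ∑ i ∈ s, i.1 ⊗ₜ[k] i.2) : ∑ i ∈ s, i.1 * S i.2 = wb.projL x := by
  rw [← hS.convAlong_right, convAlong_apply_of_eq_sum _ _ hs]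
  rfl

lemma antipode_one : S 1 = 1 := by
  obtain ⟨s, hs⟩ := wb.exists_comul_eq_sum 1
  have h : ∑ i ∈ s, S i.1 * i.2 = 1 := by
    rw [hS.sum_antipode_mul hs, projR_one]
  calc S 1 = S 1 * ∑ i ∈ s, S i.1 * i.2 := by rw [h, mul_one]
    _ = ∑ i ∈ s, S i.1 * i.2 := by
      rw [Finset.mul_sum]
      refine Finset.sum_congr rfl fun i _ => ?_
      rw [← mul_assoc, ← hS.antipode_mul, mul_one]
    _ = 1 := h

lemma antipode_of_isL {z : H} (hz : wb.IsL z) : S z = wb.projR z := by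
  obtain ⟨s, hs⟩ := wb.exists_comul_eq_sum 1
  have h : ∑ i ∈ s, S i.1 * i.2 = 1 := by
    rw [hS.sum_antipode_mul hs, projR_one]
  rw [← hS.convAlong_left, convAlong_apply, hz.comul_right, hs]
  simp [Finset.sum_mul, hS.antipode_mul, mul_assoc, ← Finset.mul_sum, h]

lemma antipode_of_isR {w : H} (hw : wb.IsR w) : S w = wb.projL w := by
  obtain ⟨s, hs⟩ := wb.exists_comul_eq_sum 1
  have h : ∑ i ∈ s, i.1 * S i.2 = 1 := by
    rw [hS.sum_mul_antipode hs, projL_one]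
  rw [← hS.convAlong_right, convAlong_apply, hw.comul_left, hs]
  simp [Finset.mul_sum, hS.antipode_mul, ← mul_assoc, ← Finset.sum_mul, h]

lemma antipode_projBarR (x : H) : S (wb.projBarR x) = wb.projR x := by
  rw [hS.antipode_of_isL (wb.isL_projBarR x), projR_projBarR]

lemma antipode_projBarL (x : H) : S (wb.projBarL x) = wb.projL x := by
  rw [hS.antipode_of_isR (wb.isR_projBarL x), projL_projBarL]

/-- The antipode is an epimorphism with respect to multiplicative maps. -/
lemma ext_of_comp {R : Type*} [Ring R] [Algebra k R] {σ τ : H →ₗ[k] R}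
    (hσ : ∀ a b, σ (a * b) = σ a * σ b) (hτ : ∀ a b, τ (a * b) = τ a * τ b)
    (h : σ ∘ₗ S = τ ∘ₗ S) : σ = τ := by
  have hR : σ ∘ₗ wb.projR = τ ∘ₗ wb.projR := LinearMap.ext fun x => by
    simpa [hS.antipode_projBarR] using LinearMap.congr_fun h (wb.projBarR x)
  have hL : σ ∘ₗ wb.projL = τ ∘ₗ wb.projL := LinearMap.ext fun x => by
    simpa [hS.antipode_projBarL] using LinearMap.congr_fun h (wb.projBarL x)
  calc σ = σ ∘ₗ convAlong wb.comul LinearMap.id wb.projR := by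
        rw [convAlong_id_projR, LinearMap.comp_id]
    _ = convAlong wb.comul σ (convAlong wb.comul (σ ∘ₗ S) τ) := by
        rw [comp_convAlong _ _ hσ, hR, ← hS.convAlong_left, comp_convAlong _ _ hτ, h]
        rfl
    _ = convAlong wb.comul (τ ∘ₗ wb.projL) τ := by
        rw [← convAlong_comul_assoc, ← hL, ← hS.convAlong_right, comp_convAlong _ _ hσ]
        rfl
    _ = τ := by
        conv_rhs => rw [← LinearMap.comp_id τ, ← hS.convAlong_projL_id, comp_convAlong _ _ hτ]
        rfl

lemma ext_of_comp_sq {R : Type*} [Ring R] [Algebra k R] {σ τ : H →ₗ[k] R}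
    (hσ : ∀ a b, σ (a * b) = σ a * σ b) (hτ : ∀ a b, τ (a * b) = τ a * τ b)
    (h : σ ∘ₗ S ∘ₗ S = τ ∘ₗ S ∘ₗ S) : σ = τ := by
  refine hS.ext_of_comp hσ hτ ?_
  let e : R ≃ₗ[k] Rᵐᵒᵖ := MulOpposite.opLinearEquiv k
  have h' : e.toLinearMap ∘ₗ σ ∘ₗ S = e.toLinearMap ∘ₗ τ ∘ₗ S := by
    refine hS.ext_of_comp (fun a b => ?_) (fun a b => ?_) ?_
    · simp [e, hS.antipode_mul, hσ]
    · simp [e, hS.antipode_mul, hτ]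
    · rw [LinearMap.comp_assoc, LinearMap.comp_assoc, LinearMap.comp_assoc, LinearMap.comp_assoc, h]
  ext x
  exact e.injective (LinearMap.congr_fun h' x)

lemma pow_sq_mul (n : ℕ) (a b : H) :
    ((S ∘ₗ S) ^ n) (a * b) = ((S ∘ₗ S) ^ n) a * ((S ∘ₗ S) ^ n) b := by
  induction n generalizing a b with
  | zero => simp
  | succ n ih => simp [pow_succ, hS.antipode_mul, ih]

lemma ext_of_comp_pow {R : Type*} [Ring R] [Algebra k R] (n : ℕ) {σ τ : H →ₗ[k] R}
    (hσ : ∀ a b, σ (a * b) = σ a * σ b) (hτ : ∀ a b, τ (a * b) = τ a * τ b)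
    (h : σ ∘ₗ (S ∘ₗ S) ^ n = τ ∘ₗ (S ∘ₗ S) ^ n) : σ = τ := by
  induction n with
  | zero => exact h
  | succ n ih =>
    refine ih (hS.ext_of_comp_sq (fun a b => ?_) (fun a b => ?_) ?_)
    · simp [hS.pow_sq_mul, hσ]
    · simp [hS.pow_sq_mul, hτ]
    · rw [pow_succ] at h
      exact h

/-- The antipode of a weak Hopf algebra (which is finite-dimensional here) is injective. -/
theorem antipode_injective : Function.Injective S := by
  obtain ⟨m, hm⟩ := Filter.eventually_atTop.mp
    (LinearMap.eventually_isCompl_ker_pow_range_pow (S ∘ₗ S : Module.End k H))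
  let F : H →ₗ[k] H := (S ∘ₗ S) ^ (m + 1)
  have hc : IsCompl (LinearMap.range F) (LinearMap.ker F) := (hm (m + 1) (by lia)).symm
  have hF : ∀ a b, F (a * b) = F a * F b := hS.pow_sq_mul (m + 1)
  let π := (LinearMap.range F).projection (LinearMap.ker F) hc
  have hπ : ∀ a b, π (a * b) = π a * π b := by
    intro a b
    have h₁ : π (π a * π b) = π a * π b := by
      apply Submodule.projection_apply_of_mem_left
      obtain ⟨x, hx⟩ := Submodule.projection_apply_mem hc a
      obtain ⟨y, hy⟩ := Submodule.projection_apply_mem hc b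
      exact ⟨x * y, by rw [hF, hx, hy]⟩
    have h₂ : π (a * b - π a * π b) = 0 := by
      refine (Submodule.projection_apply_eq_zero_iff hc).mpr ?_
      have ha : F a = F (π a) := by
        have := Submodule.sub_projection_mem hc a
        rwa [LinearMap.mem_ker, map_sub, sub_eq_zero] at this
      have hb : F b = F (π b) := by
        have := Submodule.sub_projection_mem hc b
        rwa [LinearMap.mem_ker, map_sub, sub_eq_zero] at this
      rw [LinearMap.mem_ker, map_sub, hF, hF, ha, hb, sub_self]
    rw [map_sub, h₁, sub_eq_zero] at h₂
    exact h₂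
  have hid : π = LinearMap.id := by
    refine hS.ext_of_comp_pow (m + 1) hπ (fun _ _ => rfl) (LinearMap.ext fun x => ?_)
    exact Submodule.projection_apply_of_mem_left hc ⟨x, rfl⟩
  have hker : LinearMap.ker F = ⊥ := by
    rw [eq_bot_iff]
    intro x hx
    have := (Submodule.projection_apply_eq_zero_iff hc).mpr hx
    change π x = 0 at this
    rwa [hid] at this
  intro x y hxy
  refine LinearMap.ker_eq_bot.mp hker ?_
  simp [F, pow_succ, hxy]

end IsAntipode

end WeakBialgebra

namespace WeakBialgebra

variable {k : Type*} [Field k] {H : Type*} [Ring H] [Algebra k H] [FiniteDimensional k H]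
variable {wb : WeakBialgebra k H}

lemma convAlong_mk_flip_one_mk_one (wb : WeakBialgebra k H) (f g : H →ₗ[k] H) :
    convAlong wb.comul ((TensorProduct.mk k H H).flip 1 ∘ₗ f) (TensorProduct.mk k H H 1 ∘ₗ g) =
      TensorProduct.map f g ∘ₗ wb.comul := by
  ext x
  rw [convAlong_apply, LinearMap.comp_apply]
  induction wb.comul x with
  | zero => simp
  | add x y hx hy => simp only [map_add, hx, hy]
  | tmul a b => simp

/-- `Π^L(1₍₁₎) ⊗ Π^R(1₍₂₎) = 1₍₂₎ ⊗ 1₍₁₎`. -/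
lemma map_projL_projR_comul_one :
    TensorProduct.map wb.projL wb.projR (wb.comul 1) =
      TensorProduct.comm k H H (wb.comul 1) := by
  have key : ∀ t : H ⊗[k] H, TensorProduct.map wb.projL wb.projR t = ∑ l, (∑ j,
      LinearMap.mul' k k (TensorProduct.map
        (wb.counit ∘ₗ mulLeft k (wb.legR ((Module.finBasis k H).coord j)))
        (wb.counit ∘ₗ mulRight k (wb.legL ((Module.finBasis k H).coord l))) t) •
        Module.finBasis k H j) ⊗ₜ[k] Module.finBasis k H l := by
    intro t
    induction t with
    | zero => simp
    | add x y hx hy =>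
      simp only [map_add, add_smul, add_tmul, Finset.sum_add_distrib, hx, hy]
    | tmul a b =>
      rw [map_tmul, projL_eq_sum, projR_eq_sum, tmul_sum]
      refine Finset.sum_congr rfl fun l _ => ?_
      rw [← smul_tmul, Finset.smul_sum]
      congr 1
      exact Finset.sum_congr rfl fun j _ => by simp [smul_smul, mul_comm]
  conv_rhs => rw [comul_one_eq_sum_legL, map_sum]
  rw [key]
  refine Finset.sum_congr rfl fun l _ => ?_
  rw [TensorProduct.comm_tmul]
  congr 1
  conv_rhs => rw [← projL_of_isL wb (wb.isL_legL _), projL_eq_sum]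
  refine Finset.sum_congr rfl fun j _ => ?_
  rw [← wb.weak_counit₁, mul_one]

namespace IsAntipode

variable {S : H →ₗ[k] H} (hS : wb.IsAntipode S)
include hS

lemma map_antipode_comul_one :
    TensorProduct.map S S (wb.comul 1) = TensorProduct.comm k H H (wb.comul 1) := by
  rw [← map_projL_projR_comul_one]
  trans TensorProduct.map wb.projL S (wb.comul 1)
  · rw [comul_one_eq_sum_legR, map_sum, map_sum]
    exact Finset.sum_congr rfl fun j _ => by
      rw [map_tmul, map_tmul, hS.antipode_of_isR (wb.isR_legR _)]
  · rw [comul_one_eq_sum_legL, map_sum, map_sum]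
    exact Finset.sum_congr rfl fun j _ => by
      rw [map_tmul, map_tmul, hS.antipode_of_isL (wb.isL_legL _)]

lemma comm_map_antipode_mul (s t : H ⊗[k] H) :
    TensorProduct.comm k H H (TensorProduct.map S S (s * t)) =
      TensorProduct.comm k H H (TensorProduct.map S S t) *
        TensorProduct.comm k H H (TensorProduct.map S S s) := by
  induction s with
  | zero => simp
  | add x y hx hy => simp only [map_add, add_mul, mul_add, hx, hy]
  | tmul a b =>
    induction t with
    | zero => simp
    | add x y hx hy => simp only [map_add, add_mul, mul_add, hx, hy]
    | tmul c d => simp [hS.antipode_mul]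

/-- `S(x₍₁₎)x₍₂₎ ⊗ x₍₃₎ = 1₍₁₎ ⊗ x1₍₂₎`. -/
lemma convAlong_antipode_comul :
    convAlong wb.comul ((TensorProduct.mk k H H).flip 1 ∘ₗ S) wb.comul =
      mulRight k (wb.comul 1) ∘ₗ TensorProduct.mk k H H 1 := by
  let i₁ : H →ₗ[k] H ⊗[k] H := (TensorProduct.mk k H H).flip 1
  let i₂ : H →ₗ[k] H ⊗[k] H := TensorProduct.mk k H H 1
  have hi₁ : ∀ a b, i₁ (a * b) = i₁ a * i₁ b := fun a b => by simp [i₁]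
  have hP : convAlong wb.comul i₁ i₂ = wb.comul := by
    simpa using wb.convAlong_mk_flip_one_mk_one LinearMap.id LinearMap.id
  have h₁ : convAlong wb.comul (i₁ ∘ₗ S) i₁ = i₁ ∘ₗ wb.projR := by
    rw [← hS.convAlong_left, comp_convAlong _ _ hi₁, LinearMap.comp_id]
  calc convAlong wb.comul (i₁ ∘ₗ S) wb.comul
      = convAlong wb.comul (i₁ ∘ₗ S) (convAlong wb.comul i₁ i₂) := by rw [hP]
    _ = TensorProduct.map wb.projR LinearMap.id ∘ₗ wb.comul := by
      rw [← convAlong_comul_assoc, h₁, ← convAlong_mk_flip_one_mk_one, LinearMap.comp_id]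
    _ = mulRight k (wb.comul 1) ∘ₗ i₂ := LinearMap.ext wb.rTensor_projR_comul

/-- The antipode is anticomultiplicative. -/
theorem comul_antipode (x : H) :
    wb.comul (S x) = TensorProduct.comm k H H (TensorProduct.map S S (wb.comul x)) := by
  let i₁ : H →ₗ[k] H ⊗[k] H := (TensorProduct.mk k H H).flip 1
  let i₂ : H →ₗ[k] H ⊗[k] H := TensorProduct.mk k H H 1
  have hi₁ : ∀ a b, i₁ (a * b) = i₁ a * i₁ b := fun a b => by simp [i₁]
  have hi₂ : ∀ a b, i₂ (a * b) = i₂ a * i₂ b := fun a b => by simp [i₂]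
  have conv₁₂ : ∀ f g : H →ₗ[k] H, convAlong wb.comul (i₁ ∘ₗ f) (i₂ ∘ₗ g) =
      TensorProduct.map f g ∘ₗ wb.comul := wb.convAlong_mk_flip_one_mk_one
  have conv₂₁ : ∀ f g : H →ₗ[k] H, convAlong wb.comul (i₂ ∘ₗ f) (i₁ ∘ₗ g) =
      (TensorProduct.comm k H H).toLinearMap ∘ₗ TensorProduct.map f g ∘ₗ wb.comul := by
    intro f g
    ext x
    rw [convAlong_apply, LinearMap.comp_apply, LinearMap.comp_apply]
    induction wb.comul x with
    | zero => simp
    | add x y hx hy => simp only [map_add, hx, hy]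
    | tmul a b => simp [i₁, i₂]
  have hP : convAlong wb.comul i₁ i₂ = wb.comul := by
    simpa using conv₁₂ LinearMap.id LinearMap.id
  let D' : H →ₗ[k] H ⊗[k] H := convAlong wb.comul (i₂ ∘ₗ S) (i₁ ∘ₗ S)
  have hD' : ∀ x, D' x = TensorProduct.comm k H H (TensorProduct.map S S (wb.comul x)) :=
    fun x => LinearMap.congr_fun (conv₂₁ S S) x
  have comul_one_mul_D' : mulLeft k (wb.comul 1) ∘ₗ D' = D' := by
    have h1 : D' 1 = wb.comul 1 := by
      rw [hD', hS.map_antipode_comul_one]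
      exact (TensorProduct.comm k H H).symm_apply_apply _
    ext x
    rw [LinearMap.comp_apply, mulLeft_apply, ← h1, hD', hD', ← hS.comm_map_antipode_mul,
      comul_mul_one]
  have right : convAlong wb.comul wb.comul D' = wb.comul ∘ₗ wb.projL := by
    have h : convAlong wb.comul i₁ (i₂ ∘ₗ wb.projL) = mulLeft k (wb.comul 1) ∘ₗ i₁ := by
      rw [← LinearMap.comp_id i₁, conv₁₂]
      exact LinearMap.ext wb.lTensor_projL_comul
    have h₁ : convAlong wb.comul i₁ (i₁ ∘ₗ S) = i₁ ∘ₗ wb.projL := by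
      rw [← hS.convAlong_right, comp_convAlong _ _ hi₁, LinearMap.comp_id]
    have h₂ : convAlong wb.comul i₂ (i₂ ∘ₗ S) = i₂ ∘ₗ wb.projL := by
      rw [← hS.convAlong_right, comp_convAlong _ _ hi₂, LinearMap.comp_id]
    calc convAlong wb.comul wb.comul D'
        = convAlong wb.comul (convAlong wb.comul i₁ i₂) D' := by rw [hP]
      _ = convAlong wb.comul (convAlong wb.comul i₁ (convAlong wb.comul i₂ (i₂ ∘ₗ S)))
          (i₁ ∘ₗ S) := by simp only [D', convAlong_comul_assoc]
      _ = mulLeft k (wb.comul 1) ∘ₗ i₁ ∘ₗ wb.projL := by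
        rw [h₂, h, convAlong_mulLeft, h₁]
      _ = wb.comul ∘ₗ wb.projL :=
        LinearMap.ext fun x => (wb.isL_projL x).comul_right.symm
  have left : convAlong wb.comul D' wb.comul = mulRight k (wb.comul 1) ∘ₗ i₂ ∘ₗ wb.projR := by
    have h₂ : convAlong wb.comul (i₂ ∘ₗ S) i₂ = i₂ ∘ₗ wb.projR := by
      rw [← hS.convAlong_left, comp_convAlong _ _ hi₂, LinearMap.comp_id]
    calc convAlong wb.comul D' wb.comul
        = convAlong wb.comul (i₂ ∘ₗ S) (convAlong wb.comul (i₁ ∘ₗ S) wb.comul) :=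
          convAlong_comul_assoc ..
      _ = mulRight k (wb.comul 1) ∘ₗ i₂ ∘ₗ wb.projR := by
        rw [hS.convAlong_antipode_comul, convAlong_mulRight, h₂]
  have mid : convAlong wb.comul D' (convAlong wb.comul wb.comul D') = D' := by
    rw [← convAlong_comul_assoc, left, convAlong_mulRight_left, comul_one_mul_D',
      ← convAlong_comul_assoc, ← comp_convAlong _ _ hi₂, hS.convAlong_projR_self]
  have main : wb.comul ∘ₗ S = D' := by
    refine convAlong_inverse_unique (f := wb.comul) wb.coassoc ?_ ?_ ?_ mid
    · have := comp_convAlong wb.comul wb.comul wb.comul_mul S LinearMap.id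
      rw [LinearMap.comp_id, hS.convAlong_left] at this
      rw [left, ← this]
      exact LinearMap.ext fun x => (wb.isR_projR x).comul_left
    · have := comp_convAlong wb.comul wb.comul wb.comul_mul LinearMap.id S
      rw [LinearMap.comp_id, hS.convAlong_right] at this
      rw [right, ← this]
    · have := comp_convAlong wb.comul wb.comul wb.comul_mul LinearMap.id S
      rw [LinearMap.comp_id] at this
      rw [← this, ← comp_convAlong _ _ wb.comul_mul, hS.convAlong_right, hS.convAlong_self_projL]
  rw [← hD', ← main, LinearMap.comp_apply]

end IsAntipode

end WeakBialgebra

namespace WeakBialgebra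

variable {k : Type*} [Field k] {H : Type*} [Ring H] [Algebra k H] [FiniteDimensional k H]
variable (wb : WeakBialgebra k H)

/-- The operator `x ↦ χ(x₍₁₎) x₍₂₎`. -/
def evalLeft (χ : H →ₗ[k] k) : H →ₗ[k] H :=
  (TensorProduct.lid k H).toLinearMap ∘ₗ rTensor H χ ∘ₗ wb.comul

/-- The operator `x ↦ x₍₁₎ φ(x₍₂₎)`. -/
def evalRight (φ : H →ₗ[k] k) : H →ₗ[k] H :=
  (TensorProduct.rid k H).toLinearMap ∘ₗ lTensor H φ ∘ₗ wb.comul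

lemma evalLeft_apply (χ : H →ₗ[k] k) (x : H) :
    wb.evalLeft χ x = TensorProduct.lid k H (rTensor H χ (wb.comul x)) := rfl

lemma evalLeft_sum {ι : Type*} (s : Finset ι) (χ : ι → H →ₗ[k] k) :
    wb.evalLeft (∑ i ∈ s, χ i) = ∑ i ∈ s, wb.evalLeft (χ i) := by
  have h : rTensor H (∑ i ∈ s, χ i) = ∑ i ∈ s, rTensor H (χ i) :=
    map_sum (LinearMap.rTensorHom H) χ s
  ext x
  simp [evalLeft_apply, h]

lemma evalRight_apply (φ : H →ₗ[k] k) (x : H) :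
    wb.evalRight φ x = TensorProduct.rid k H (lTensor H φ (wb.comul x)) := rfl

lemma evalLeft_comp_evalRight (χ φ : H →ₗ[k] k) :
    wb.evalLeft χ ∘ₗ wb.evalRight φ = wb.evalRight φ ∘ₗ wb.evalLeft χ := by
  ext x
  have h₁ : ∀ t : H ⊗[k] H, wb.evalLeft χ (TensorProduct.rid k H (lTensor H φ t)) =
      TensorProduct.lid k H (TensorProduct.map χ
        ((TensorProduct.rid k H).toLinearMap ∘ₗ lTensor H φ)
        (TensorProduct.assoc k H H H (rTensor H wb.comul t))) := by
    intro t
    induction t with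
    | zero => simp
    | add x y hx hy => simp only [map_add, hx, hy]
    | tmul a b =>
      rw [lTensor_tmul, rid_tmul, map_smul, rTensor_tmul, evalLeft_apply]
      induction wb.comul a with
      | zero => simp
      | add x y hx hy => simp only [map_add, add_tmul, smul_add, hx, hy]
      | tmul c d => simp [smul_smul, mul_comm]
  have h₂ : ∀ t : H ⊗[k] H, wb.evalRight φ (TensorProduct.lid k H (rTensor H χ t)) =
      TensorProduct.lid k H (TensorProduct.map χ
        ((TensorProduct.rid k H).toLinearMap ∘ₗ lTensor H φ) (lTensor H wb.comul t)) := by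
    intro t
    induction t with
    | zero => simp
    | add x y hx hy => simp only [map_add, hx, hy]
    | tmul a b => simp [evalRight_apply]
  rw [LinearMap.comp_apply, LinearMap.comp_apply, evalRight_apply, h₁, wb.coassoc, ← h₂,
    evalLeft_apply]

lemma evalLeft_comp_evalLeft (χ χ' : H →ₗ[k] k) :
    wb.evalLeft χ ∘ₗ wb.evalLeft χ' = wb.evalLeft (convAlong wb.comul χ' χ) := by
  ext x
  have h₁ : ∀ t : H ⊗[k] H, wb.evalLeft χ (TensorProduct.lid k H (rTensor H χ' t)) =
      TensorProduct.lid k H (TensorProduct.map χ'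
        ((TensorProduct.lid k H).toLinearMap ∘ₗ rTensor H χ) (lTensor H wb.comul t)) := by
    intro t
    induction t with
    | zero => simp
    | add x y hx hy => simp only [map_add, hx, hy]
    | tmul a b => simp [evalLeft_apply]
  have h₂ : ∀ t : H ⊗[k] H,
      TensorProduct.lid k H (rTensor H (convAlong wb.comul χ' χ) t) =
      TensorProduct.lid k H (TensorProduct.map χ'
        ((TensorProduct.lid k H).toLinearMap ∘ₗ rTensor H χ)
        (TensorProduct.assoc k H H H (rTensor H wb.comul t))) := by
    intro t
    induction t with
    | zero => simp
    | add x y hx hy => simp only [map_add, hx, hy]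
    | tmul a b =>
      rw [rTensor_tmul, rTensor_tmul, convAlong_apply]
      induction wb.comul a with
      | zero => simp
      | add x y hx hy => simp only [map_add, add_tmul, hx, hy]
      | tmul c d => simp [smul_smul, mul_comm]
  rw [LinearMap.comp_apply, evalLeft_apply _ χ', h₁, ← wb.coassoc, ← h₂, ← evalLeft_apply]

variable {wb}

namespace IsAntipode

variable {S : H →ₗ[k] H} (hS : wb.IsAntipode S)
include hS

lemma sum_evalLeft_comp_mulRight (ψ : H →ₗ[k] k) (x : H) :
    ∑ l, wb.evalLeft (ψ ∘ₗ mulLeft k (Module.finBasis k H l)) ∘ₗ mulRight k x ∘ₗ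
      wb.evalLeft ((Module.finBasis k H).coord l ∘ₗ S) =
      (TensorProduct.lid k H).toLinearMap ∘ₗ rTensor H ψ ∘ₗ mulRight k (wb.comul x) ∘ₗ
        TensorProduct.mk k H H 1 := by
  ext h
  have h₁ := LinearMap.congr_fun hS.convAlong_antipode_comul h
  obtain ⟨s, hs⟩ := wb.exists_comul_eq_sum h
  rw [convAlong_apply_of_eq_sum _ _ hs, LinearMap.comp_apply, mulRight_apply,
    TensorProduct.mk_apply] at h₁
  have h₂ : ∀ (c : H) (t : H ⊗[k] H),
      ∑ l, (Module.finBasis k H).coord l c • TensorProduct.lid k H (rTensor H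
        (ψ ∘ₗ mulLeft k (Module.finBasis k H l)) t) =
      TensorProduct.lid k H (rTensor H ψ ((c ⊗ₜ[k] (1 : H)) * t)) := by
    intro c t
    induction t with
    | zero => simp
    | add x y hx hy => simp only [map_add, smul_add, mul_add, Finset.sum_add_distrib, hx, hy]
    | tmul a b =>
      conv_rhs => rw [← (Module.finBasis k H).sum_repr c, sum_tmul, Finset.sum_mul]
      simp [smul_smul]
  have h₃ : ∀ l, wb.evalLeft ((Module.finBasis k H).coord l ∘ₗ S) h =
      ∑ i ∈ s, (Module.finBasis k H).coord l (S i.1) • i.2 := by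
    intro l
    rw [evalLeft_apply, hs]
    simp
  simp only [LinearMap.sum_apply, LinearMap.comp_apply, mulRight_apply, TensorProduct.mk_apply,
    LinearEquiv.coe_coe]
  calc _ = ∑ i ∈ s, ∑ l, (Module.finBasis k H).coord l (S i.1) •
          TensorProduct.lid k H (rTensor H (ψ ∘ₗ mulLeft k (Module.finBasis k H l))
            (wb.comul (i.2 * x))) := by
        rw [Finset.sum_comm]
        refine Finset.sum_congr rfl fun l _ => ?_
        rw [h₃, Finset.sum_mul, map_sum]
        exact Finset.sum_congr rfl fun i _ => by rw [smul_mul_assoc, map_smul, evalLeft_apply]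
    _ = TensorProduct.lid k H (rTensor H ψ
          ((∑ i ∈ s, ((S i.1) ⊗ₜ[k] (1 : H)) * wb.comul i.2) * wb.comul x)) := by
        rw [Finset.sum_mul, map_sum, map_sum]
        refine Finset.sum_congr rfl fun i _ => ?_
        rw [h₂, wb.comul_mul, mul_assoc]
    _ = _ := by
        have h₄ : ∑ i ∈ s, ((S i.1) ⊗ₜ[k] (1 : H)) * wb.comul i.2 =
          ((1 : H) ⊗ₜ[k] h) * wb.comul 1 := h₁
        rw [h₄, mul_assoc, comul_one_mul]

variable {T : H →ₗ[k] H} (hST : ∀ x, S (T x) = x)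
include hST

lemma leftInverse_inv (x : H) : T (S x) = x := hS.antipode_injective (hST _)

lemma inv_mul (x y : H) : T (x * y) = T y * T x :=
  hS.antipode_injective (by rw [hST, hS.antipode_mul, hST, hST])

lemma inv_one : T 1 = 1 := hS.antipode_injective (by rw [hST, hS.antipode_one])

lemma inv_projR (x : H) : T (wb.projR x) = wb.projBarR x := by
  rw [← hS.antipode_projBarR, hS.leftInverse_inv hST]

lemma inv_of_isR {w : H} (hw : wb.IsR w) : T w = wb.projBarR w := by
  conv_lhs => rw [← wb.projR_of_isR hw]
  exact hS.inv_projR hST w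

lemma comul_inv (x : H) :
    wb.comul (T x) = TensorProduct.comm k H H (TensorProduct.map T T (wb.comul x)) := by
  have key : ∀ t : H ⊗[k] H, TensorProduct.comm k H H (TensorProduct.map T T
      (TensorProduct.comm k H H (TensorProduct.map S S t))) = t := by
    intro t
    induction t with
    | zero => simp
    | add x y hx hy => simp only [map_add, hx, hy]
    | tmul a b => simp [hS.leftInverse_inv hST]
  conv_rhs => rw [← hST x, hS.comul_antipode, key]

lemma comul_inv_sq (x : H) :
    wb.comul (T (T x)) = TensorProduct.map (T ∘ₗ T) (T ∘ₗ T) (wb.comul x) := by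
  rw [hS.comul_inv hST, hS.comul_inv hST]
  induction wb.comul x with
  | zero => simp
  | add x y hx hy => simp only [map_add, hx, hy]
  | tmul a b => simp

/-- `S⁻¹(x₍₂₎) x₍₁₎ = Π̄^R(x)`. -/
lemma sum_inv_mul {x : H} {s : Finset (H × H)}
    (hs : wb.comul x = ∑ i ∈ s, i.1 ⊗ₜ[k] i.2) : ∑ i ∈ s, T i.2 * i.1 = wb.projBarR x := by
  rw [← hS.inv_projR hST, ← hS.sum_antipode_mul hs, map_sum]
  exact Finset.sum_congr rfl fun i _ => by
    rw [hS.inv_mul hST, hS.leftInverse_inv hST]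

lemma evalLeft_comp_inv_sq (χ : H →ₗ[k] k) :
    wb.evalLeft (χ ∘ₗ S) ∘ₗ T ∘ₗ T = (T ∘ₗ T) ∘ₗ wb.evalLeft (χ ∘ₗ T) := by
  ext x
  rw [LinearMap.comp_apply, evalLeft_apply, LinearMap.comp_apply, hS.comul_inv_sq hST,
    LinearMap.comp_apply, evalLeft_apply]
  induction wb.comul x with
  | zero => simp
  | add x y hx hy => simp only [map_add, hx, hy]
  | tmul a b => simp [hST]

lemma evalLeft_comp_projBarR (ψ : H →ₗ[k] k) :
    wb.evalLeft (ψ ∘ₗ wb.projBarR) = mulRight k (wb.legL (ψ ∘ₗ T)) := by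
  ext g
  have h : rTensor H (ψ ∘ₗ wb.projBarR) (wb.comul g) =
      rTensor H (ψ ∘ₗ T) (rTensor H wb.projR (wb.comul g)) := by
    induction wb.comul g with
    | zero => simp
    | add x y hx hy => simp only [map_add, hx, hy]
    | tmul a b => simp [hS.inv_projR hST]
  rw [evalLeft_apply, h, rTensor_projR_comul, mulRight_apply, legL]
  induction wb.comul 1 with
  | zero => simp
  | add x y hx hy => simp only [map_add, mul_add, hx, hy]
  | tmul a b => simp

lemma sum_evalLeft_comp_evalLeft (ψ : H →ₗ[k] k) :
    ∑ l, wb.evalLeft ((Module.finBasis k H).coord l ∘ₗ T) ∘ₗ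
      wb.evalLeft (ψ ∘ₗ mulLeft k (Module.finBasis k H l)) = mulRight k (wb.legL (ψ ∘ₗ T)) := by
  rw [← hS.evalLeft_comp_projBarR hST]
  have h : ψ ∘ₗ wb.projBarR = ∑ l, convAlong wb.comul (ψ ∘ₗ mulLeft k (Module.finBasis k H l))
      ((Module.finBasis k H).coord l ∘ₗ T) := by
    ext g
    obtain ⟨s, hs⟩ := wb.exists_comul_eq_sum g
    have h₁ : ∀ l, convAlong wb.comul (ψ ∘ₗ mulLeft k (Module.finBasis k H l))
        ((Module.finBasis k H).coord l ∘ₗ T) g = ∑ i ∈ s,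
        ψ (Module.finBasis k H l * i.1) * (Module.finBasis k H).coord l (T i.2) := fun l =>
      convAlong_apply_of_eq_sum _ _ hs
    rw [LinearMap.comp_apply, ← hS.sum_inv_mul hST hs, map_sum, LinearMap.sum_apply]
    simp_rw [h₁]
    rw [Finset.sum_comm]
    refine Finset.sum_congr rfl fun i _ => ?_
    conv_lhs => rw [← (Module.finBasis k H).sum_repr (T i.2), Finset.sum_mul, map_sum]
    simp [mul_comm]
  rw [h]
  rw [evalLeft_sum]
  exact Finset.sum_congr rfl fun l _ => evalLeft_comp_evalLeft ..

end IsAntipode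

/-- The functional `x ↦ Tr(h ↦ T²(h₍₁₎' φ(h₍₂₎')))` with `h' = hx`; for `T = S⁻¹` it is an
integral with values in `H^L`. -/
def traceIntegral (wb : WeakBialgebra k H) (T : H →ₗ[k] H) (φ : H →ₗ[k] k) : H →ₗ[k] k :=
  LinearMap.trace k H ∘ₗ LinearMap.llcomp k H H H ((T ∘ₗ T) ∘ₗ wb.evalRight φ) ∘ₗ
    (LinearMap.mul k H).flip

lemma traceIntegral_apply (T : H →ₗ[k] H) (φ : H →ₗ[k] k) (x : H) :
    wb.traceIntegral T φ x =
      LinearMap.trace k H (((T ∘ₗ T) ∘ₗ wb.evalRight φ) ∘ₗ mulRight k x) := rfl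

lemma apply_rid_lTensor_traceIntegral (T : H →ₗ[k] H) (φ ψ : H →ₗ[k] k) (t : H ⊗[k] H) :
    ψ (TensorProduct.rid k H (lTensor H (wb.traceIntegral T φ) t)) =
      LinearMap.trace k H (((T ∘ₗ T) ∘ₗ wb.evalRight φ) ∘ₗ
        (TensorProduct.lid k H).toLinearMap ∘ₗ rTensor H ψ ∘ₗ mulRight k t ∘ₗ
        TensorProduct.mk k H H 1) := by
  induction t with
  | zero => simp
  | add x y hx hy =>
    have h : mulRight k (x + y) = mulRight k x + mulRight k y :=
      LinearMap.ext fun _ => mul_add ..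
    simp only [h, map_add, hx, hy, LinearMap.add_comp, LinearMap.comp_add]
  | tmul a b =>
    have h : (TensorProduct.lid k H).toLinearMap ∘ₗ rTensor H ψ ∘ₗ mulRight k (a ⊗ₜ[k] b) ∘ₗ
        TensorProduct.mk k H H 1 = ψ a • mulRight k b := by
      ext; simp
    rw [h, LinearMap.comp_smul, map_smul, ← traceIntegral_apply]
    simp [mul_comm]

namespace IsAntipode

variable {S : H →ₗ[k] H} (hS : wb.IsAntipode S) {T : H →ₗ[k] H} (hST : ∀ x, S (T x) = x)
include hS hST

/-- `x₍₁₎ λ(x₍₂₎) = S⁻¹(1₍₁₎) λ(x1₍₂₎)` for `λ = traceIntegral`. -/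
lemma evalRight_traceIntegral (φ : H →ₗ[k] k) (x : H) :
    wb.evalRight (wb.traceIntegral T φ) x = ∑ j,
      wb.traceIntegral T φ (x * Module.finBasis k H j) •
        T (wb.legR ((Module.finBasis k H).coord j)) := by
  refine (Module.finBasis k H).ext_elem fun i => ?_
  set ψ := (Module.finBasis k H).coord i with hψ
  set R := wb.evalRight φ with hR
  change ψ _ = ψ _
  have h : wb.legL (ψ ∘ₗ T) = ∑ j, ψ (T (wb.legR ((Module.finBasis k H).coord j))) •
      Module.finBasis k H j := by
    rw [legL, comul_one_eq_sum_legR]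
    simp
  have comp_sum (f : H →ₗ[k] H) (g : Fin (Module.finrank k H) → H →ₗ[k] H) :
      f ∘ₗ ∑ l, g l = ∑ l, f ∘ₗ g l := Finset.mul_sum (R := Module.End k H) ..
  have sum_comp (f : H →ₗ[k] H) (g : Fin (Module.finrank k H) → H →ₗ[k] H) :
      (∑ l, g l) ∘ₗ f = ∑ l, g l ∘ₗ f := Finset.sum_mul (R := Module.End k H) ..
  have cyc : ∀ l, LinearMap.trace k H (((T ∘ₗ T) ∘ₗ R) ∘ₗ
      (wb.evalLeft (ψ ∘ₗ mulLeft k (Module.finBasis k H l)) ∘ₗ mulRight k x ∘ₗ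
        wb.evalLeft ((Module.finBasis k H).coord l ∘ₗ S))) =
      LinearMap.trace k H (((T ∘ₗ T) ∘ₗ R) ∘ₗ
        (wb.evalLeft ((Module.finBasis k H).coord l ∘ₗ T) ∘ₗ
          wb.evalLeft (ψ ∘ₗ mulLeft k (Module.finBasis k H l))) ∘ₗ mulRight k x) := by
    intro l
    have h₁ := hS.evalLeft_comp_inv_sq hST ((Module.finBasis k H).coord l)
    have h₂ := wb.evalLeft_comp_evalRight ((Module.finBasis k H).coord l ∘ₗ T) φ
    set A := wb.evalLeft ((Module.finBasis k H).coord l ∘ₗ S)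
    set B := wb.evalLeft (ψ ∘ₗ mulLeft k (Module.finBasis k H l))
    set C := wb.evalLeft ((Module.finBasis k H).coord l ∘ₗ T)
    calc _ = LinearMap.trace k H ((((T ∘ₗ T) ∘ₗ R) ∘ₗ B ∘ₗ mulRight k x) ∘ₗ A) := rfl
      _ = LinearMap.trace k H (A ∘ₗ (((T ∘ₗ T) ∘ₗ R) ∘ₗ B ∘ₗ mulRight k x)) :=
        LinearMap.trace_mul_comm k _ _
      _ = LinearMap.trace k H ((A ∘ₗ T ∘ₗ T) ∘ₗ R ∘ₗ B ∘ₗ mulRight k x) := rfl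
      _ = LinearMap.trace k H ((T ∘ₗ T) ∘ₗ (C ∘ₗ R) ∘ₗ B ∘ₗ mulRight k x) := by rw [h₁]; rfl
      _ = _ := by rw [h₂]; rfl
  rw [evalRight_apply, apply_rid_lTensor_traceIntegral, ← hS.sum_evalLeft_comp_mulRight ψ x,
    comp_sum, map_sum, Finset.sum_congr rfl fun l _ => cyc l, ← map_sum,
    ← comp_sum, ← sum_comp, hS.sum_evalLeft_comp_evalLeft hST]
  trans wb.traceIntegral T φ (x * wb.legL (ψ ∘ₗ T))
  · rw [traceIntegral_apply]
    congr 2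
    ext y
    simp [mul_assoc]
  · rw [h]
    simp [Finset.mul_sum, mul_comm]

lemma projL_evalRight_traceIntegral (φ : H →ₗ[k] k) (x : H) :
    wb.projL (wb.evalRight (wb.traceIntegral T φ) x) =
      wb.evalRight (wb.traceIntegral T φ) x := by
  rw [hS.evalRight_traceIntegral hST, map_sum]
  refine Finset.sum_congr rfl fun j _ => ?_
  rw [map_smul, hS.inv_of_isR hST (wb.isR_legR _), projL_of_isL wb (wb.isL_projBarR _)]

/-- The integrals `traceIntegral` generate the functionals on `H`. -/
lemma sum_traceIntegral (x : H) :
    ∑ i, wb.traceIntegral T ((Module.finBasis k H).coord i) (T (Module.finBasis k H i) * x) =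
      wb.counit x := by
  set e := Module.finBasis k H with he
  have cyc : ∀ i, wb.traceIntegral T (e.coord i) (T (e i) * x) =
      LinearMap.trace k H (mulRight k (T (e i) * x) ∘ₗ (T ∘ₗ T) ∘ₗ wb.evalRight (e.coord i)) :=
    fun i => LinearMap.trace_mul_comm k ((T ∘ₗ T) ∘ₗ wb.evalRight (e.coord i))
      (mulRight k (T (e i) * x))
  have h₁ : ∑ i, mulRight k (T (e i) * x) ∘ₗ (T ∘ₗ T) ∘ₗ wb.evalRight (e.coord i) =
      mulRight k x ∘ₗ (T ∘ₗ T) ∘ₗ wb.projL := by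
    ext g
    obtain ⟨s, hs⟩ := wb.exists_comul_eq_sum g
    have h : ∀ i, wb.evalRight (e.coord i) g = ∑ p ∈ s, e.coord i p.2 • p.1 := by
      intro i
      rw [evalRight_apply, hs]
      simp
    simp only [LinearMap.sum_apply, LinearMap.comp_apply, h, mulRight_apply,
      ← hS.sum_mul_antipode hs, map_sum]
    rw [Finset.sum_comm]
    refine Finset.sum_congr rfl fun p _ => ?_
    rw [hS.inv_mul hST, hS.leftInverse_inv hST, hS.inv_mul hST]
    conv_rhs => rw [← e.sum_repr p.2, map_sum, Finset.mul_sum, Finset.sum_mul]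
    simp [mul_assoc]
  have h₂ : mulRight k x ∘ₗ (T ∘ₗ T) ∘ₗ wb.projL = ∑ j,
      (wb.counit ∘ₗ mulLeft k (wb.legR (e.coord j))).smulRight (T (T (e j)) * x) := by
    ext g
    simp [projL_eq_sum, he]
  have h₃ : ∑ j, T (wb.legR (e.coord j)) * T (T (e j)) = 1 := by
    have h : ∑ j, S (wb.legR (e.coord j)) * e j = 1 := by
      rw [← wb.projR_one, ← hS.convAlong_left,
        convAlong_apply_of_eq_sum _ _ wb.comul_one_eq_sum_legR]
      rfl
    rw [← hS.inv_one hST, ← hS.inv_one hST, ← h, map_sum, map_sum]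
    refine Finset.sum_congr rfl fun j _ => ?_
    rw [hS.inv_mul hST, hS.inv_mul hST, hS.leftInverse_inv hST]
  rw [Finset.sum_congr rfl fun i _ => cyc i, ← map_sum, h₁, h₂, map_sum]
  calc _ = ∑ j, wb.counit (T (wb.legR (e.coord j)) * T (T (e j)) * x) := by
        refine Finset.sum_congr rfl fun j _ => ?_
        rw [LinearMap.trace_smulRight, hS.inv_of_isR hST (wb.isR_legR _), mul_assoc,
          counit_projBarR_mul]
        rfl
    _ = wb.counit x := by
        rw [← map_sum, ← Finset.sum_mul, h₃, one_mul]

end IsAntipode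

end WeakBialgebra

namespace WeakBialgebra

variable {k : Type*} [Field k] {H : Type*} [Ring H] [Algebra k H] [FiniteDimensional k H]
variable {wb : WeakBialgebra k H}

/-- The counit of a weak Hopf algebra is a combination of translates of integrals. -/
theorem IsAntipode.exists_sum_integral {S : H →ₗ[k] H} (hS : wb.IsAntipode S) :
    ∃ (n : ℕ) (Λ : Fin n → H →ₗ[k] k) (t : Fin n → H),
      (∀ i x, wb.projL (wb.evalRight (Λ i) x) = wb.evalRight (Λ i) x) ∧
      ∀ x, ∑ i, Λ i (t i * x) = wb.counit x := by
  let e := LinearEquiv.ofInjectiveEndo S hS.antipode_injective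
  have he : ∀ x, S (e.symm.toLinearMap x) = x := fun x => e.apply_symm_apply x
  exact ⟨_, fun i => wb.traceIntegral e.symm.toLinearMap ((Module.finBasis k H).coord i),
    fun i => e.symm.toLinearMap (Module.finBasis k H i),
    fun i => hS.projL_evalRight_traceIntegral he _, hS.sum_traceIntegral he⟩

end WeakBialgebra

namespace ComodAlg

variable {k : Type*} [Field k] {H : Type*} [Ring H] [Algebra k H] [FiniteDimensional k H]
variable {wb : WeakBialgebra k H} {A : Type*} [Ring A] [Algebra k A] (ca : ComodAlg wb A)

lemma ρ_mul_ρ_one (a : A) : ca.ρ a * ca.ρ 1 = ca.ρ a := by rw [← ca.mul, mul_one]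

lemma ρ_one_mul_ρ (a : A) : ca.ρ 1 * ca.ρ a = ca.ρ a := by rw [← ca.mul, one_mul]

lemma ρ_mul_of_mem_coinv (a : A) {b : A} (hb : b ∈ ca.coinv) :
    ca.ρ (a * b) = ca.ρ a * (b ⊗ₜ[k] (1 : H)) := by
  have hb' : ca.ρ b = ca.ρ 1 * (b ⊗ₜ[k] (1 : H)) := hb
  rw [ca.mul, hb', ← mul_assoc, ρ_mul_ρ_one]

/-- The operator `a ↦ a₍₀₎ Λ(a₍₁₎)`. -/
def average (Λ : H →ₗ[k] k) : A →ₗ[k] A :=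
  (TensorProduct.rid k A).toLinearMap ∘ₗ lTensor A Λ ∘ₗ ca.ρ

lemma average_apply (Λ : H →ₗ[k] k) (a : A) :
    ca.average Λ a = TensorProduct.rid k A (lTensor A Λ (ca.ρ a)) := rfl

lemma ρ_average (Λ : H →ₗ[k] k) (a : A) :
    ca.ρ (ca.average Λ a) = lTensor A (wb.evalRight Λ) (ca.ρ a) := by
  have h₁ : ∀ t : A ⊗[k] H, ca.ρ (TensorProduct.rid k A (lTensor A Λ t)) =
      lTensor A ((TensorProduct.rid k H).toLinearMap ∘ₗ lTensor H Λ)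
        (TensorProduct.assoc k A H H (rTensor H ca.ρ t)) := by
    intro t
    induction t with
    | zero => simp
    | add x y hx hy => simp only [map_add, hx, hy]
    | tmul a h =>
      rw [lTensor_tmul, rid_tmul, map_smul, rTensor_tmul]
      induction ca.ρ a with
      | zero => simp
      | add x y hx hy => simp only [map_add, add_tmul, smul_add, hx, hy]
      | tmul c d => simp
  have h₂ : ∀ t : A ⊗[k] H, lTensor A ((TensorProduct.rid k H).toLinearMap ∘ₗ lTensor H Λ)
      (lTensor A wb.comul t) = lTensor A (wb.evalRight Λ) t := by
    intro t
    induction t with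
    | zero => simp
    | add x y hx hy => simp only [map_add, hx, hy]
    | tmul a h => simp [WeakBialgebra.evalRight_apply]
  rw [average_apply, h₁, ca.coassoc, h₂]

lemma average_mem_coinv {Λ : H →ₗ[k] k}
    (hΛ : ∀ x, wb.projL (wb.evalRight Λ x) = wb.evalRight Λ x) (a : A) :
    ca.average Λ a ∈ ca.coinv := by
  have h : ∀ t : A ⊗[k] H, lTensor A wb.projL (lTensor A (wb.evalRight Λ) t) =
      lTensor A (wb.evalRight Λ) t := by
    intro t
    induction t with
    | zero => simp
    | add x y hx hy => simp only [map_add, hx, hy]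
    | tmul a h => simp [hΛ]
  change ca.ρ (ca.average Λ a) = _
  rw [← ca.piL, ρ_average, h]

lemma average_mul_of_mem_coinv (Λ : H →ₗ[k] k) (a : A) {b : A} (hb : b ∈ ca.coinv) :
    ca.average Λ (a * b) = ca.average Λ a * b := by
  rw [average_apply, ca.ρ_mul_of_mem_coinv a hb, rid_lTensor_mul_tmul_one, average_apply]

lemma mkA_mul_tmul (a a' : A) {b : A} (hb : b ∈ ca.coinv) :
    ca.mkA ((a * b) ⊗ₜ[k] a') = ca.mkA (a ⊗ₜ[k] (b * a')) :=
  (Submodule.Quotient.eq _).mpr (Submodule.subset_span ⟨a, a', b, hb, rfl⟩)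

/-- If the Galois map hits all `(1 ⊗ h)ρ(1)`, then the averages along integrals provide a finite
dual basis of `A` over its coinvariants. -/
theorem exists_dual_basis {S : H →ₗ[k] H} (hS : wb.IsAntipode S)
    (β : ca.QA →ₗ[k] A ⊗[k] H)
    (hβ : ∀ a a' : A, β (ca.mkA (a ⊗ₜ[k] a')) = (a ⊗ₜ[k] (1 : H)) * ca.ρ a')
    (hsurj : ∀ h : H, ((1 : A) ⊗ₜ[k] h) * ca.ρ 1 ∈ Set.range ⇑β) :
    ∃ (n : ℕ) (x y : Fin n → A) (Λ : Fin n → H →ₗ[k] k),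
      (∀ i h, wb.projL (wb.evalRight (Λ i) h) = wb.evalRight (Λ i) h) ∧
      ∀ a, ∑ i, x i * ca.average (Λ i) (y i * a) = a := by
  obtain ⟨n, Λ, t, hΛ, hsum⟩ := hS.exists_sum_integral
  have hpre : ∀ i, ∃ s : Finset (A × A),
      ∑ p ∈ s, (p.1 ⊗ₜ[k] (1 : H)) * ca.ρ p.2 = ((1 : A) ⊗ₜ[k] t i) * ca.ρ 1 := by
    intro i
    obtain ⟨q, hq⟩ := hsurj (t i)
    obtain ⟨w, rfl⟩ := Submodule.mkQ_surjective _ q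
    obtain ⟨s, rfl⟩ := TensorProduct.exists_finset w
    refine ⟨s, ?_⟩
    rw [← hq, map_sum, map_sum]
    exact Finset.sum_congr rfl fun p _ => (hβ p.1 p.2).symm
  choose s hs using hpre
  let e := Fintype.equivFin (Σ i, s i)
  refine ⟨_, fun j => (e.symm j).2.1.1, fun j => (e.symm j).2.1.2, fun j => Λ (e.symm j).1,
    fun j => hΛ _, fun a => ?_⟩
  rw [e.symm.sum_comp (fun p : Σ i, s i => p.2.1.1 * ca.average (Λ p.1) (p.2.1.2 * a)),
    Fintype.sum_sigma]
  have h : ∀ i, ∑ p : s i, p.1.1 * ca.average (Λ i) (p.1.2 * a) =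
      TensorProduct.rid k A (lTensor A (Λ i ∘ₗ mulLeft k (t i)) (ca.ρ a)) := by
    intro i
    rw [Finset.sum_coe_sort (s i) (fun p => p.1 * ca.average (Λ i) (p.2 * a))]
    trans TensorProduct.rid k A (lTensor A (Λ i) (((1 : A) ⊗ₜ[k] t i) * ca.ρ a))
    · rw [← ca.ρ_one_mul_ρ a, ← mul_assoc, ← hs, Finset.sum_mul, map_sum, map_sum]
      refine Finset.sum_congr rfl fun p _ => ?_
      rw [mul_assoc, rid_lTensor_tmul_one_mul, ← ca.mul, average_apply]
    · induction ca.ρ a with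
      | zero => simp
      | add x y hx hy => simp only [map_add, mul_add, hx, hy]
      | tmul b c => simp
  have h' : ∀ u : A ⊗[k] H, ∑ i,
      TensorProduct.rid k A (lTensor A (Λ i ∘ₗ mulLeft k (t i)) u) =
      TensorProduct.rid k A (lTensor A wb.counit u) := by
    intro u
    induction u with
    | zero => simp
    | add x y hx hy => simp only [map_add, Finset.sum_add_distrib, hx, hy]
    | tmul b c => simp [← hsum, Finset.sum_smul]
  rw [Finset.sum_congr rfl fun i _ => h i, h', ca.counital]

/-- `ρ(a₍₀₎)(1 ⊗ S(a₍₁₎)) = ρ(1)(a ⊗ 1)`. -/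
lemma convAlong_ρ_antipode {S : H →ₗ[k] H} (hS : wb.IsAntipode S) (a : A) :
    convAlong ca.ρ ca.ρ (TensorProduct.mk k A H 1 ∘ₗ S) a = ca.ρ 1 * (a ⊗ₜ[k] (1 : H)) := by
  let i₁ : A →ₗ[k] A ⊗[k] H := (TensorProduct.mk k A H).flip 1
  let i₂ : H →ₗ[k] A ⊗[k] H := TensorProduct.mk k A H 1
  have conv₁₂ : ∀ g : H →ₗ[k] H, convAlong ca.ρ i₁ (i₂ ∘ₗ g) = lTensor A g ∘ₗ ca.ρ := by
    intro g
    ext a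
    rw [convAlong_apply, LinearMap.comp_apply]
    induction ca.ρ a with
    | zero => simp
    | add x y hx hy => simp only [map_add, hx, hy]
    | tmul b c => simp [i₁, i₂]
  have hρ : convAlong ca.ρ i₁ i₂ = ca.ρ := by simpa using conv₁₂ LinearMap.id
  have hi₂ : ∀ a b, i₂ (a * b) = i₂ a * i₂ b := fun a b => by simp [i₂]
  have h : convAlong wb.comul i₂ (i₂ ∘ₗ S) = i₂ ∘ₗ wb.projL := by
    rw [← hS.convAlong_right, comp_convAlong _ _ hi₂, LinearMap.comp_id]
  calc convAlong ca.ρ ca.ρ (i₂ ∘ₗ S) a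
      = convAlong ca.ρ (convAlong ca.ρ i₁ i₂) (i₂ ∘ₗ S) a := by rw [hρ]
    _ = lTensor A wb.projL (ca.ρ a) := by
      rw [convAlong_assoc ca.coassoc, h, conv₁₂, LinearMap.comp_apply]
    _ = ca.ρ 1 * (a ⊗ₜ[k] (1 : H)) := ca.piL a

end ComodAlg

/-- for a weak Hopf algebra `H` and a right `H`-comodule algebra `A` with
coinvariants `B`, if the Galois map `β : A ⊗_B A → (A ⊗ H)ρ(1)` is surjective then `A` is
finitely generated projective as a right `B`-module (expressed by a dual basis) and `β` is
bijective, i.e. `A | B` is a weak `H`-Galois extension. -/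
theorem statement11 {k : Type*} [Field k] {H : Type*} [Ring H] [Algebra k H]
    [FiniteDimensional k H] (wb : WeakBialgebra k H) (S : H →ₗ[k] H) (hS : wb.IsAntipode S)
    {A : Type*} [Ring A] [Algebra k A] (ca : ComodAlg wb A)
    (β : ca.QA →ₗ[k] A ⊗[k] H)
    (hβ : ∀ a a' : A, β (ca.mkA (a ⊗ₜ[k] a')) = (a ⊗ₜ[k] (1 : H)) * ca.ρ a')
    (hsurj : ∀ z ∈ Set.range (fun w : A ⊗[k] H => w * ca.ρ 1), z ∈ Set.range ⇑β) :
    -- `A` is a finitely generated projective right `B`-module: it has a finite dual basis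
    (∃ (n : ℕ) (x : Fin n → A) (φ : Fin n → A →+ A),
      (∀ (i : Fin n) (a : A), φ i a ∈ ca.coinv) ∧
      (∀ (i : Fin n) (a : A), ∀ b ∈ ca.coinv, φ i (a * b) = φ i a * b) ∧
      (∀ a : A, ∑ i, x i * φ i a = a)) ∧
    -- and `β` is bijective onto `(A ⊗ H)ρ(1)`
    Function.Injective β ∧
    Set.range ⇑β = Set.range (fun w : A ⊗[k] H => w * ca.ρ 1) := by
  obtain ⟨n, x, y, Λ, hΛ, hsum⟩ :=
    ca.exists_dual_basis hS β hβ fun h => hsurj _ ⟨(1 : A) ⊗ₜ[k] h, rfl⟩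
  refine ⟨⟨n, x, fun i => (ca.average (Λ i) ∘ₗ mulLeft k (y i)).toAddMonoidHom,
    fun i a => ca.average_mem_coinv (hΛ i) _, fun i a b hb => ?_, hsum⟩, ?_, ?_⟩
  · change ca.average (Λ i) (y i * (a * b)) = ca.average (Λ i) (y i * a) * b
    rw [← mul_assoc, ca.average_mul_of_mem_coinv _ _ hb]
  · let Φ : A ⊗[k] H →ₗ[k] A ⊗[k] H :=
      LinearMap.mul' k (A ⊗[k] H) ∘ₗ TensorProduct.map ca.ρ (TensorProduct.mk k A H 1 ∘ₗ S)
    have hΦ_mul : ∀ (a : A) (t : A ⊗[k] H), Φ ((a ⊗ₜ[k] (1 : H)) * t) = ca.ρ a * Φ t := by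
      intro a t
      induction t with
      | zero => simp
      | add u v hu hv => simp only [map_add, mul_add, hu, hv]
      | tmul b h => simp [Φ, ca.mul, mul_assoc]
    have hΦ : ∀ a a' : A, Φ (β (ca.mkA (a ⊗ₜ[k] a'))) = ca.ρ a * (a' ⊗ₜ[k] (1 : H)) := by
      intro a a'
      have h : Φ (ca.ρ a') = ca.ρ 1 * (a' ⊗ₜ[k] (1 : H)) := ca.convAlong_ρ_antipode hS a'
      rw [hβ, hΦ_mul, h, ← mul_assoc, ca.ρ_mul_ρ_one]
    have recover : ∀ z : A ⊗[k] A, ca.mkA z = ∑ i, ca.mkA (x i ⊗ₜ[k]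
        TensorProduct.rid k A (lTensor A (Λ i) (ca.ρ (y i) * Φ (β (ca.mkA z))))) := by
      intro z
      induction z with
      | zero => simp
      | add u v hu hv =>
        simp only [map_add, mul_add, tmul_add, Finset.sum_add_distrib]
        rw [← hu, ← hv]
      | tmul a a' =>
        conv_lhs => rw [← hsum a, sum_tmul, map_sum]
        refine Finset.sum_congr rfl fun i _ => ?_
        rw [ca.mkA_mul_tmul _ _ (ca.average_mem_coinv (hΛ i) _), hΦ, ← mul_assoc, ← ca.mul,
          rid_lTensor_mul_tmul_one, ComodAlg.average_apply]
    refine (injective_iff_map_eq_zero β).mpr fun q hq => ?_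
    obtain ⟨z, rfl⟩ := Submodule.mkQ_surjective _ q
    have hq' : β (ca.mkA z) = 0 := hq
    change ca.mkA z = 0
    rw [recover, hq']
    simp
  · refine Set.Subset.antisymm ?_ hsurj
    rintro _ ⟨q, rfl⟩
    obtain ⟨z, rfl⟩ := Submodule.mkQ_surjective _ q
    refine ⟨β (ca.mkA z), ?_⟩
    change β (ca.mkA z) * ca.ρ 1 = β (ca.mkA z)
    induction z with
    | zero => simp
    | add u v hu hv => simp only [map_add, add_mul, hu, hv]
    | tmul a a' => rw [hβ, mul_assoc, ca.ρ_mul_ρ_one]
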